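/- arXiv:1302.4589 — 4 statements merged into one kernel-verified Lean document; each statement's English description precedes it below -/
import Mathlib

section
/- Let Ω ⊆ ℝ^n be an open convex set and φ a positive convex function on Ω. Then for every β > n: (∫_Ω φ^{-β} dx)(∫_Ω φ^{-β-2} dx) ≤ [β(β - n + 1)]/[(β+1)(β-n)] · (∫_Ω φ^{-β-1} dx)², assuming all three integrals are finite. -/
open MeasureTheory Set
open scoped ENNReal Pointwise

lemma rh_bm_compact {a b : ℝ} (ha : 0 < a) (hb : 0 < b) {K L C : Set ℝ}
    (hK : IsCompact K) (hL : IsCompact L) (hKn : K.Nonempty) (hLn : L.Nonempty)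
    (h : ∀ x ∈ K, ∀ y ∈ L, a * x + b * y ∈ C) :
    ENNReal.ofReal a * volume K + ENNReal.ofReal b * volume L ≤ volume C := by
  obtain ⟨k, hk, hkm⟩ := hK.exists_isGreatest hKn
  obtain ⟨l, hl, hlm⟩ := hL.exists_isLeast hLn
  have key : ∀ (c d : ℝ) (S : Set ℝ), 0 < c → 
      volume ((fun x => c * x + d) '' S) = ENNReal.ofReal c * volume S := by
    intro c d S hc
    have : (fun x => c * x + d) '' S = (fun x => x + d) '' (c • S) := by
      rw [← image_smul, image_image]; rfl
    rw [this, image_add_right, measure_preimage_add_right, Measure.addHaar_smul]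
    simp [abs_of_pos hc]
  rw [← key a (b * l) K ha, ← key b (a * k) L hb, ← measure_union₀]
  · apply measure_mono
    rintro z (⟨x, hx, rfl⟩ | ⟨y, hy, rfl⟩)
    · exact h x hx l hl
    · simpa [add_comm] using h k hk y hy
  · apply MeasurableSet.nullMeasurableSet
    exact (hL.image (by fun_prop)).measurableSet
  · refine measure_mono_null (t := {a * k + b * l}) ?_ (by simp)
    rintro z ⟨⟨x, hx, rfl⟩, ⟨y, hy, hxy⟩⟩
    have h1 := hkm hx
    have h2 := hlm hy
    simp only [mem_singleton_iff] at *
    nlinarith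

lemma rh_bm {a b : ℝ} (ha : 0 < a) (hb : 0 < b) {A B C : Set ℝ}
    (hA : MeasurableSet A) (hB : MeasurableSet B) (hAn : A.Nonempty) (hBn : B.Nonempty)
    (h : ∀ x ∈ A, ∀ y ∈ B, a * x + b * y ∈ C) :
    ENNReal.ofReal a * volume A + ENNReal.ofReal b * volume B ≤ volume C := by
  have key : ∀ S : Set ℝ, MeasurableSet S → S.Nonempty →
      volume S ≤ ⨆ K : {K : Set ℝ // K ⊆ S ∧ IsCompact K ∧ K.Nonempty}, volume K.1 := by
    rintro S hS ⟨x, hx⟩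
    apply le_of_forall_lt
    intro r hr
    obtain ⟨K, hKS, hK, hrK⟩ := hS.exists_lt_isCompact hr
    refine lt_of_lt_of_le hrK ?_
    refine le_iSup_of_le ⟨insert x K, insert_subset hx hKS, hK.insert x, insert_nonempty _ _⟩ ?_
    exact measure_mono (subset_insert _ _)
  obtain ⟨x, hx⟩ := id hAn
  obtain ⟨y, hy⟩ := id hBn
  have : Nonempty {K : Set ℝ // K ⊆ A ∧ IsCompact K ∧ K.Nonempty} :=
    ⟨⟨{x}, by simpa using hx, isCompact_singleton, by simp⟩⟩
  have : Nonempty {K : Set ℝ // K ⊆ B ∧ IsCompact K ∧ K.Nonempty} :=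
    ⟨⟨{y}, by simpa using hy, isCompact_singleton, by simp⟩⟩
  refine (add_le_add (mul_le_mul_right (key A hA hAn) _) (mul_le_mul_right (key B hB hBn) _)).trans ?_
  rw [ENNReal.mul_iSup, ENNReal.mul_iSup]
  refine ENNReal.iSup_add_iSup_le ?_
  rintro ⟨K, hK1, hK2, hK3⟩ ⟨L, hL1, hL2, hL3⟩
  exact rh_bm_compact ha hb hK2 hL2 hK3 hL3 fun x hx y hy => h x (hK1 hx) y (hL1 hy)

/-- normalised one-dimensional Prékopa–Leindler -/
lemma rh_pl_norm {a b : ℝ} (ha : 0 < a) (hb : 0 < b) (hab : a + b = 1) {f g h : ℝ → ℝ}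
    (hf : Measurable f) (hg : Measurable g) (hh : Measurable h)
    (hf0 : ∀ x, 0 ≤ f x) (hg0 : ∀ x, 0 ≤ g x) (hh0 : ∀ x, 0 ≤ h x)
    (hf1 : ∀ x, f x ≤ 1) (hg1 : ∀ x, g x ≤ 1)
    (hfs : ∀ t < 1, ∃ x, t < f x) (hgs : ∀ t < 1, ∃ x, t < g x)
    (H : ∀ x y, f x ^ a * g y ^ b ≤ h (a * x + b * y)) :
    ENNReal.ofReal a * (∫⁻ x, ENNReal.ofReal (f x)) + ENNReal.ofReal b *
      (∫⁻ x, ENNReal.ofReal (g x)) ≤ ∫⁻ x, ENNReal.ofReal (h x) := by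
  rw [lintegral_eq_lintegral_meas_lt _ (.of_forall hf0) hf.aemeasurable,
    lintegral_eq_lintegral_meas_lt _ (.of_forall hg0) hg.aemeasurable,
    lintegral_eq_lintegral_meas_lt _ (.of_forall hh0) hh.aemeasurable]
  have hmeas : ∀ u : ℝ → ℝ, Measurable fun t : ℝ => volume {x | t < u x} := by
    intro u
    apply Antitone.measurable
    intro s t hst
    exact measure_mono fun x hx => lt_of_le_of_lt hst hx
  rw [← lintegral_const_mul _ (hmeas f), ← lintegral_const_mul _ (hmeas g),
    ← lintegral_add_left ((hmeas f).const_mul _)]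
  refine setLIntegral_mono (hmeas h) ?_
  intro t ht
  have ht : 0 < t := ht
  rcases lt_or_ge t 1 with ht1 | ht1
  · refine rh_bm ha hb (measurableSet_lt measurable_const hf) (measurableSet_lt measurable_const hg)
      (hfs t ht1) (hgs t ht1) ?_
    intro x hx y hy
    refine lt_of_lt_of_le ?_ (H x y)
    calc t = t ^ a * t ^ b := by rw [← Real.rpow_add ht, hab, Real.rpow_one]
      _ < f x ^ a * g y ^ b := by
        apply mul_lt_mul'' (Real.rpow_lt_rpow ht.le hx ha) (Real.rpow_lt_rpow ht.le hy hb) <;> positivity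
  · have e1 : {x | t < f x} = ∅ := by
      ext x; simpa using (hf1 x).trans ht1
    have e2 : {x | t < g x} = ∅ := by
      ext x; simpa using (hg1 x).trans ht1
    simp [e1, e2]

lemma rh_amgm {a b : ℝ} (ha : 0 < a) (hb : 0 < b) (hab : a + b = 1) (x y : ℝ≥0∞) :
    x ^ a * y ^ b ≤ ENNReal.ofReal a * x + ENNReal.ofReal b * y := by
  by_cases hx : x = ∞
  · simp [hx, ENNReal.mul_top, ha]
  by_cases hy : y = ∞
  · simp [hy, ENNReal.mul_top, hb]
  lift x to NNReal using hx
  lift y to NNReal using hy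
  have := NNReal.geom_mean_le_arith_mean2_weighted a.toNNReal b.toNNReal x y 
    (by rw [← Real.toNNReal_add ha.le hb.le, hab]; simp)
  rw [Real.coe_toNNReal _ ha.le, Real.coe_toNNReal _ hb.le] at this
  rw [ENNReal.ofReal, ENNReal.ofReal, ← ENNReal.coe_rpow_of_nonneg _ ha.le, ← ENNReal.coe_rpow_of_nonneg _ hb.le]
  exact_mod_cast this

lemma rh_pl_bdd {a b : ℝ} (ha : 0 < a) (hb : 0 < b) (hab : a + b = 1) {f g h : ℝ → ℝ}
    (hf : Measurable f) (hg : Measurable g) (hh : Measurable h)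
    (hf0 : ∀ x, 0 ≤ f x) (hg0 : ∀ x, 0 ≤ g x) (hh0 : ∀ x, 0 ≤ h x)
    (hf1 : BddAbove (range f)) (hg1 : BddAbove (range g))
    (H : ∀ x y, f x ^ a * g y ^ b ≤ h (a * x + b * y)) :
    (∫⁻ x, ENNReal.ofReal (f x)) ^ a * 
      (∫⁻ x, ENNReal.ofReal (g x)) ^ b ≤ ∫⁻ x, ENNReal.ofReal (h x) := by
  set S := ⨆ x, f x with hS
  set T := ⨆ x, g x with hT
  have hfS : ∀ x, f x ≤ S := fun x => le_ciSup hf1 x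
  have hgT : ∀ x, g x ≤ T := fun x => le_ciSup hg1 x
  rcases ((hf0 0).trans (hfS 0)).eq_or_lt with hS0 | hS0
  · have : ∀ x, f x = 0 := fun x => le_antisymm (hS0 ▸ hfS x) (hf0 x)
    simp [this, ha]
  rcases ((hg0 0).trans (hgT 0)).eq_or_lt with hT0 | hT0
  · have : ∀ x, g x = 0 := fun x => le_antisymm (hT0 ▸ hgT x) (hg0 x)
    simp [this, hb]
  have hSa := Real.rpow_pos_of_pos hS0 a
  have hTb := Real.rpow_pos_of_pos hT0 b
  have key := rh_pl_norm ha hb hab (f := fun x => S⁻¹ * f x) (g := fun x => T⁻¹ * g x)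
    (h := fun x => (S ^ a * T ^ b)⁻¹ * h x) (hf.const_mul _) (hg.const_mul _) (hh.const_mul _)
    (fun x => mul_nonneg (by positivity) (hf0 x)) (fun x => mul_nonneg (by positivity) (hg0 x))
    (fun x => mul_nonneg (by positivity) (hh0 x)) 
    (fun x => by rw [inv_mul_le_iff₀ hS0]; simpa using hfS x)
    (fun x => by rw [inv_mul_le_iff₀ hT0]; simpa using hgT x)
    (by
      intro t ht
      obtain ⟨x, hx⟩ := exists_lt_of_lt_ciSup (show t * S < ⨆ x, f x by rw [← hS]; nlinarith)
      exact ⟨x, by rw [lt_inv_mul_iff₀ hS0]; linarith⟩)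
    (by
      intro t ht
      obtain ⟨x, hx⟩ := exists_lt_of_lt_ciSup (show t * T < ⨆ x, g x by rw [← hT]; nlinarith)
      exact ⟨x, by rw [lt_inv_mul_iff₀ hT0]; linarith⟩)
    (by
      intro x y
      rw [Real.mul_rpow (by positivity) (hf0 x), Real.mul_rpow (by positivity) (hg0 y),
        Real.inv_rpow hS0.le, Real.inv_rpow hT0.le, mul_inv]
      calc _ = (S ^ a)⁻¹ * (T ^ b)⁻¹ * (f x ^ a * g y ^ b) := by ring
        _ ≤ _ := mul_le_mul_of_nonneg_left (H x y) (by positivity))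
  have e : ∀ (c : ℝ) (u : ℝ → ℝ), 0 < c → Measurable u → 
      ∫⁻ x, ENNReal.ofReal (c * u x) = ENNReal.ofReal c * ∫⁻ x, ENNReal.ofReal (u x) := by
    intro c u hc hu
    rw [← lintegral_const_mul _ hu.ennreal_ofReal]
    simp_rw [ENNReal.ofReal_mul hc.le]
  have key2 := (rh_amgm ha hb hab _ _).trans key
  rw [e _ _ (by positivity) hf, e _ _ (by positivity) hg, e _ _ (by positivity) hh,
    ENNReal.mul_rpow_of_nonneg _ _ ha.le, ENNReal.mul_rpow_of_nonneg _ _ hb.le,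
    ENNReal.ofReal_rpow_of_pos (by positivity), ENNReal.ofReal_rpow_of_pos (by positivity),
    Real.inv_rpow hS0.le, Real.inv_rpow hT0.le] at key2
  have key3 := mul_le_mul_right key2 (ENNReal.ofReal (S ^ a * T ^ b))
  rw [← mul_assoc _ _ (∫⁻ x, ENNReal.ofReal (h x)), ← ENNReal.ofReal_mul (by positivity),
    mul_inv_cancel₀ (by positivity), ENNReal.ofReal_one, one_mul] at key3
  refine le_trans (le_of_eq ?_) key3
  rw [mul_mul_mul_comm, ← ENNReal.ofReal_mul (by positivity), ← mul_assoc,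
    ← ENNReal.ofReal_mul (by positivity), ← mul_inv, mul_inv_cancel₀ (by positivity)]
  simp

def RhPL (α : Type*) [AddCommGroup α] [Module ℝ α] [MeasureSpace α] : Prop :=
  ∀ (a b : ℝ), 0 < a → 0 < b → a + b = 1 → ∀ f g h : α → ℝ≥0∞, 
    Measurable f → Measurable g → Measurable h → 
    (∀ x y, f x ^ a * g y ^ b ≤ h (a • x + b • y)) →
    (∫⁻ x, f x) ^ a * (∫⁻ x, g x) ^ b ≤ ∫⁻ x, h x

lemma rh_pl_real : RhPL ℝ := by
  intro a b ha hb hab f g h hf hg hh H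
  by_cases hf0 : ∫⁻ x, f x = 0
  · simp [hf0, ha]
  by_cases hg0 : ∫⁻ x, g x = 0
  · simp [hg0, hb]
  have hk : ∀ k : ℕ, (∫⁻ x, min (f x) k) ^ a * (∫⁻ x, min (g x) k) ^ b ≤ ∫⁻ x, h x := by
    intro k
    have ht : ∀ z : ℝ≥0∞, min z (k : ℝ≥0∞) ≠ ∞ := fun z => 
      ne_top_of_le_ne_top (ENNReal.natCast_ne_top k) (min_le_right _ _)
    have hbd : ∀ u : ℝ → ℝ≥0∞, BddAbove (range fun x => (min (u x) (k : ℝ≥0∞)).toReal) := by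
      intro u
      refine ⟨k, ?_⟩
      rintro _ ⟨x, rfl⟩
      simpa using ENNReal.toReal_mono (ENNReal.natCast_ne_top k) (min_le_right (u x) (k : ℝ≥0∞))
    have := rh_pl_bdd ha hb hab (f := fun x => (min (f x) (k : ℝ≥0∞)).toReal)
      (g := fun x => (min (g x) (k : ℝ≥0∞)).toReal) (h := fun x => (min (h x) (k : ℝ≥0∞)).toReal)
      (hf.min measurable_const).ennreal_toReal (hg.min measurable_const).ennreal_toReal
      (hh.min measurable_const).ennreal_toReal (fun _ => ENNReal.toReal_nonneg)
      (fun _ => ENNReal.toReal_nonneg) (fun _ => ENNReal.toReal_nonneg) (hbd f) (hbd g) ?_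
    · simp_rw [ENNReal.ofReal_toReal (ht _)] at this
      exact this.trans (lintegral_mono fun x => min_le_left _ _)
    · intro x y
      rw [ENNReal.toReal_rpow, ENNReal.toReal_rpow, ← ENNReal.toReal_mul]
      refine ENNReal.toReal_mono (ht _) (le_min ?_ ?_)
      · refine le_trans (mul_le_mul' (ENNReal.rpow_le_rpow (min_le_left _ _) ha.le) 
          (ENNReal.rpow_le_rpow (min_le_left _ _) hb.le)) (H x y)
      · refine le_trans (mul_le_mul' (ENNReal.rpow_le_rpow (min_le_right _ _) ha.le) 
          (ENNReal.rpow_le_rpow (min_le_right _ _) hb.le)) ?_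
        rw [← ENNReal.rpow_add_of_nonneg _ _ ha.le hb.le, hab, ENNReal.rpow_one]
  have hlim : ∀ u : ℝ → ℝ≥0∞, Measurable u → 
      Filter.Tendsto (fun k : ℕ => ∫⁻ x, min (u x) (k : ℝ≥0∞)) Filter.atTop (nhds (∫⁻ x, u x)) := by
    intro u hu
    refine lintegral_tendsto_of_tendsto_of_monotone (fun k => (hu.min measurable_const).aemeasurable) ?_ ?_
    · refine .of_forall fun x i j hij => min_le_min_left _ (by exact_mod_cast hij)
    · refine .of_forall fun x => ?_
      have := (tendsto_const_nhds (x := u x)).min ENNReal.tendsto_nat_nhds_top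
      simpa using this
  refine le_of_tendsto' (ENNReal.Tendsto.mul ((hlim f hf).ennrpow_const a) (.inl ?_) 
    ((hlim g hg).ennrpow_const b) (.inl ?_)) hk
  · simp [ENNReal.rpow_eq_zero_iff, hf0, ha.le, ha]
  · simp [ENNReal.rpow_eq_zero_iff, hg0, hb.le, hb]

lemma rh_pl_prod {α β : Type*} [AddCommGroup α] [Module ℝ α] [MeasureSpace α]
    [AddCommGroup β] [Module ℝ β] [MeasureSpace β] [SFinite (volume : Measure β)]
    [SFinite (volume : Measure α)]
    (h1 : RhPL α) (h2 : RhPL β) : RhPL (α × β) := by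
  intro a b ha hb hab f g h hf hg hh H
  rw [Measure.volume_eq_prod, lintegral_prod _ hf.aemeasurable, lintegral_prod _ hg.aemeasurable, 
    lintegral_prod _ hh.aemeasurable]
  refine h1 a b ha hb hab _ _ _ hf.lintegral_prod_right' hg.lintegral_prod_right' 
    hh.lintegral_prod_right' fun x y => ?_
  exact h2 a b ha hb hab _ _ _ (hf.comp measurable_prodMk_left) (hg.comp measurable_prodMk_left)
    (hh.comp measurable_prodMk_left) fun xx yy => H (x, xx) (y, yy)

lemma rh_pl_equiv {α β : Type*} [AddCommGroup α] [Module ℝ α] [MeasureSpace α]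
    [AddCommGroup β] [Module ℝ β] [MeasureSpace β] (e : α → β) (he : MeasurePreserving e)
    (hl : ∀ (a b : ℝ) x y, e (a • x + b • y) = a • e x + b • e y) (h1 : RhPL α) : RhPL β := by
  intro a b ha hb hab f g h hf hg hh H
  rw [← he.lintegral_comp hf, ← he.lintegral_comp hg, ← he.lintegral_comp hh]
  exact h1 a b ha hb hab _ _ _ (hf.comp he.measurable) (hg.comp he.measurable)
    (hh.comp he.measurable) fun x y => by
      simp only [hl]; exact H _ _

lemma rh_pl_pi (n : ℕ) : RhPL (Fin n → ℝ) := by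
  induction n with
  | zero =>
    intro a b ha hb hab f g h hf hg hh H
    have hv : volume (univ : Set (Fin 0 → ℝ)) = 1 := by
      rw [volume_pi, Measure.pi_of_empty (fun _ => volume) default]; simp
    simp only [lintegral_unique, hv, mul_one]
    convert H default default
  | succ n ih =>
    refine rh_pl_equiv _ (volume_preserving_piFinSuccAbove (fun _ : Fin (n + 1) => ℝ) 0).symm ?_
      (rh_pl_prod rh_pl_real ih)
    rintro a b ⟨x, xx⟩ ⟨y, yy⟩
    ext i
    refine Fin.cases ?_ (fun j => ?_) i <;> simp [MeasurableEquiv.piFinSuccAbove, Fin.insertNthEquiv]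

lemma rh_pl_euclidean (n : ℕ) : RhPL (EuclideanSpace ℝ (Fin n)) :=
  rh_pl_equiv _ (PiLp.volume_preserving_toLp (Fin n)) (fun _ _ _ _ => rfl) (rh_pl_pi n)

lemma rh_cross (w d : ℝ → ℝ) (hw : ∀ t, 0 < t → 0 < w t)
    (i0 : IntegrableOn (fun t => w t * d t) (Ioi 0))
    (i1 : IntegrableOn (fun t => w t * (t * d t)) (Ioi 0))
    (i2 : IntegrableOn (fun t => w t * (t ^ 2 * d t)) (Ioi 0))
    (hc : ∀ s u t, 0 < s → s < u → u < t → 0 < d s → 0 < d t → 0 < d u)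
    (D0 : ∫ t in Ioi 0, w t * d t = 0) (D1 : ∫ t in Ioi 0, w t * (t * d t) = 0) :
    ∫ t in Ioi 0, w t * (t ^ 2 * d t) ≤ 0 := by
  set I : Set ℝ := {t | 0 < t ∧ 0 < d t} with hI
  rcases I.eq_empty_or_nonempty with hIe | hIn
  · refine setIntegral_nonpos measurableSet_Ioi fun t ht => ?_
    have h1 : ¬ (0 < t ∧ 0 < d t) := fun h => by
      have : t ∈ I := h
      rw [hIe] at this; exact this
    have ht : 0 < t := ht
    have h2 : d t ≤ 0 := by
      by_contra h; exact h1 ⟨ht, not_le.1 h⟩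
    have := hw t ht
    exact mul_nonpos_of_nonneg_of_nonpos this.le (mul_nonpos_of_nonneg_of_nonpos (by positivity) h2)
  have hbb : BddBelow I := ⟨0, fun t ht => ht.1.le⟩
  set l := sInf I with hl
  have hlt : ∀ t, 0 < t → t < l → d t ≤ 0 := by
    intro t ht htl
    by_contra h
    exact absurd (csInf_le hbb (show t ∈ I from ⟨ht, not_le.1 h⟩)) (not_le.2 htl)
  by_cases hba : BddAbove I
  · set r := sSup I with hr
    have hrt : ∀ t, 0 < t → r < t → d t ≤ 0 := by
      intro t ht htl
      by_contra h
      exact absurd (le_csSup hba (show t ∈ I from ⟨ht, not_le.1 h⟩)) (not_le.2 htl)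
    have hmid : ∀ t, l < t → t < r → 0 < d t := by
      intro t h1 h2
      obtain ⟨s, hs, hst⟩ := exists_lt_of_csInf_lt hIn h1
      obtain ⟨u, hu, htu⟩ := exists_lt_of_lt_csSup hIn h2
      exact hc s t u hs.1 hst htu hs.2 hu.2
    have hlr : l ≤ r := csInf_le_csSup hIn hbb hba
    have hq : ∫ t in Ioi 0, w t * ((t - l) * (t - r) * d t) ≤ 0 := by
      refine setIntegral_nonpos_ae measurableSet_Ioi ?_
      have hne : ∀ᵐ t : ℝ, t ≠ l ∧ t ≠ r :=
        (Measure.ae_ne volume l).and (Measure.ae_ne volume r)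
      filter_upwards [hne] with t hne ht
      have ht : 0 < t := ht
      refine mul_nonpos_of_nonneg_of_nonpos (hw t ht).le ?_
      rcases lt_or_gt_of_ne hne.1 with h1 | h1
      · exact mul_nonpos_of_nonneg_of_nonpos (by nlinarith) (hlt t ht h1)
      · rcases lt_or_gt_of_ne hne.2 with h2 | h2
        · exact mul_nonpos_of_nonpos_of_nonneg (by nlinarith) (hmid t h1 h2).le
        · exact mul_nonpos_of_nonneg_of_nonpos (by nlinarith) (hrt t ht h2)
    have e : ∫ t in Ioi 0, w t * ((t - l) * (t - r) * d t) = 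
        (∫ t in Ioi 0, w t * (t ^ 2 * d t)) - (l + r) * (∫ t in Ioi 0, w t * (t * d t)) 
          + (l * r) * ∫ t in Ioi 0, w t * d t := by
      rw [← integral_const_mul, ← integral_const_mul, ← integral_sub i2 (i1.const_mul _),
        ← integral_add (f := fun t => w t * (t ^ 2 * d t) - (l + r) * (w t * (t * d t)))
          (Integrable.sub i2 (Integrable.const_mul i1 _)) (i0.const_mul _)]
      congr 1; ext t; ring
    rw [e, D0, D1] at hq
    linarith
  · have hmid : ∀ t, l < t → 0 < d t := by
      intro t h1
      obtain ⟨s, hs, hst⟩ := exists_lt_of_csInf_lt hIn h1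
      obtain ⟨u, hu, htu⟩ := not_bddAbove_iff.1 hba t
      exact hc s t u hs.1 hst htu hs.2 hu.2
    have e : ∫ t in Ioi 0, w t * ((t - l) * d t) = 
        (∫ t in Ioi 0, w t * (t * d t)) - l * ∫ t in Ioi 0, w t * d t := by
      rw [← integral_const_mul, ← integral_sub i1 (i0.const_mul _)]
      congr 1; ext t; ring
    have ie : IntegrableOn (fun t => w t * ((t - l) * d t)) (Ioi 0) := by
      refine (i1.sub (i0.const_mul l)).congr (.of_forall fun t => ?_)
      simp only [Pi.sub_apply]; ring
    rw [D0, D1] at e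
    rw [show (0:ℝ) - l * 0 = 0 by ring] at e
    rw [setIntegral_eq_zero_iff_of_nonneg_ae ?_ ie] at e
    · apply le_of_eq
      refine integral_eq_zero_of_ae ?_
      filter_upwards [e, ae_restrict_mem measurableSet_Ioi, ae_restrict_of_ae (Measure.ae_ne volume l)] with t h1 h2 h3
      have := (hw t h2).ne'
      have h4 : t - l ≠ 0 := sub_ne_zero.2 h3
      simp only [Pi.zero_apply, mul_eq_zero, this, h4, false_or] at h1
      simp [h1]
    · filter_upwards [ae_restrict_mem measurableSet_Ioi, ae_restrict_of_ae (Measure.ae_ne volume l)] with t h2 h3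
      refine mul_nonneg (hw t h2).le ?_
      rcases lt_or_gt_of_ne h3 with h | h
      · exact mul_nonneg_of_nonpos_of_nonpos (by linarith) (hlt t h2 h)
      · exact mul_nonneg (by linarith) (hmid t h).le

lemma rh_gamma {q c : ℝ} (hq : 0 < q) (hc : 0 < c) :
    IntegrableOn (fun t : ℝ => t ^ (q - 1) * Real.exp (-(c * t))) (Ioi 0) := by
  have := integrableOn_rpow_mul_exp_neg_mul_rpow (p := 1) (s := q - 1) (by linarith) one_pos hc
  simpa using this

lemma rh_moment {p : ℝ} (hp : 0 < p) (h : ℝ → ℝ) (hpos : ∀ t, 0 < t → 0 < h t)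
    (hlc : ∀ s t, 0 < s → 0 < t → ∀ a b, 0 < a → 0 < b → a + b = 1 →
      h s ^ a * h t ^ b ≤ h (a * s + b * t))
    (i0 : IntegrableOn (fun t => t ^ (p - 1) * h t) (Ioi 0))
    (i1 : IntegrableOn (fun t => t ^ (p - 1) * (t * h t)) (Ioi 0))
    (i2 : IntegrableOn (fun t => t ^ (p - 1) * (t ^ 2 * h t)) (Ioi 0)) :
    (∫ t in Ioi 0, t ^ (p - 1) * h t) * (∫ t in Ioi 0, t ^ (p - 1) * (t ^ 2 * h t)) ≤
      (p + 1) / p * (∫ t in Ioi 0, t ^ (p - 1) * (t * h t)) ^ 2 := by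
  have hposint : ∀ u : ℝ → ℝ, (∀ t, 0 < t → 0 < u t) → IntegrableOn u (Ioi 0) → 
      0 < ∫ t in Ioi 0, u t := by
    intro u hu hi
    rw [setIntegral_pos_iff_support_of_nonneg_ae _ hi]
    · have : Function.support u ∩ Ioi 0 = Ioi 0 := inter_eq_right.2 fun t ht => (hu t ht).ne'
      simp [this]
    · filter_upwards [ae_restrict_mem measurableSet_Ioi] with t ht using (hu t ht).le
  have hM0 := hposint _ (fun t ht => mul_pos (Real.rpow_pos_of_pos ht _) (hpos t ht)) i0
  have hM1 := hposint _ (fun t ht => mul_pos (Real.rpow_pos_of_pos ht _) (mul_pos ht (hpos t ht))) i1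
  set M0 := ∫ t in Ioi 0, t ^ (p - 1) * h t
  set M1 := ∫ t in Ioi 0, t ^ (p - 1) * (t * h t)
  set M2 := ∫ t in Ioi 0, t ^ (p - 1) * (t ^ 2 * h t)
  obtain ⟨c, hcdef⟩ : ∃ c, c = p * M0 / M1 := ⟨_, rfl⟩
  have hc : 0 < c := by rw [hcdef]; positivity
  have hG := Real.Gamma_pos_of_pos hp
  obtain ⟨A, hAdef⟩ : ∃ A, A = M0 * c ^ p / Real.Gamma p := ⟨_, rfl⟩
  have hA : 0 < A := by rw [hAdef]; positivity
  have e1 : EqOn (fun t : ℝ => t ^ (p + 1 - 1) * Real.exp (-(c * t)))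
      (fun t => t ^ (p - 1) * (t * Real.exp (-(c * t)))) (Ioi 0) := by
    intro t ht
    simp only
    rw [show p + 1 - 1 = (p - 1) + 1 by ring, Real.rpow_add ht, Real.rpow_one]; ring
  have e2 : EqOn (fun t : ℝ => t ^ (p + 2 - 1) * Real.exp (-(c * t)))
      (fun t => t ^ (p - 1) * (t ^ 2 * Real.exp (-(c * t)))) (Ioi 0) := by
    intro t ht
    simp only
    rw [show p + 2 - 1 = (p - 1) + 2 by ring, Real.rpow_add ht, Real.rpow_two]; ring
  have j0 := rh_gamma hp hc
  have j1 := (integrableOn_congr_fun e1 measurableSet_Ioi).1 (rh_gamma (q := p + 1) (by linarith) hc)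
  have j2 := (integrableOn_congr_fun e2 measurableSet_Ioi).1 (rh_gamma (q := p + 2) (by linarith) hc)
  have cp := Real.rpow_pos_of_pos hc p
  have g0 : ∫ t in Ioi 0, t ^ (p - 1) * Real.exp (-(c * t)) = Real.Gamma p / c ^ p := by
    rw [Real.integral_rpow_mul_exp_neg_mul_Ioi hp hc, one_div, Real.inv_rpow hc.le]; field_simp
  have g1 : ∫ t in Ioi 0, t ^ (p - 1) * (t * Real.exp (-(c * t))) = p * Real.Gamma p / c ^ p / c := by
    rw [← setIntegral_congr_fun measurableSet_Ioi e1, 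
      Real.integral_rpow_mul_exp_neg_mul_Ioi (by linarith) hc, one_div, Real.inv_rpow hc.le,
      Real.Gamma_add_one hp.ne', Real.rpow_add hc, Real.rpow_one]; field_simp
  have g2 : ∫ t in Ioi 0, t ^ (p - 1) * (t ^ 2 * Real.exp (-(c * t))) =
      (p + 1) * p * Real.Gamma p / c ^ p / c ^ 2 := by
    rw [← setIntegral_congr_fun measurableSet_Ioi e2, 
      Real.integral_rpow_mul_exp_neg_mul_Ioi (by linarith) hc, one_div, Real.inv_rpow hc.le,
      show p + 2 = (p + 1) + 1 by ring,
      Real.Gamma_add_one (by linarith), Real.Gamma_add_one hp.ne', 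
      show p + 1 + 1 = p + 2 by ring, Real.rpow_add hc, Real.rpow_two]; field_simp
  have s0 : ∀ t, t ^ (p - 1) * (h t - A * Real.exp (-(c * t))) = 
    t ^ (p - 1) * h t - A * (t ^ (p - 1) * Real.exp (-(c * t))) := fun t => by ring
  have s1 : ∀ t, t ^ (p - 1) * (t * (h t - A * Real.exp (-(c * t)))) = 
    t ^ (p - 1) * (t * h t) - A * (t ^ (p - 1) * (t * Real.exp (-(c * t)))) := fun t => by ring
  have s2 : ∀ t, t ^ (p - 1) * (t ^ 2 * (h t - A * Real.exp (-(c * t)))) = 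
    t ^ (p - 1) * (t ^ 2 * h t) - A * (t ^ (p - 1) * (t ^ 2 * Real.exp (-(c * t)))) := fun t => by ring
  have key := rh_cross (fun t => t ^ (p - 1)) (fun t => h t - A * Real.exp (-(c * t)))
    (fun t ht => Real.rpow_pos_of_pos ht _) 
    (by simp_rw [s0]; exact i0.sub (j0.const_mul A))
    (by simp_rw [s1]; exact i1.sub (j1.const_mul A))
    (by simp_rw [s2]; exact i2.sub (j2.const_mul A))
    (by
      intro s u t hs hsu hut h1 h2
      have ht : 0 < t := by linarith
      have hts : 0 < t - s := by linarith
      have h3 := hlc s t hs ht ((t - u) / (t - s)) ((u - s) / (t - s)) 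
        (div_pos (by linarith) hts) (div_pos (by linarith) hts) (by field_simp; ring)
      have hu : (t - u) / (t - s) * s + (u - s) / (t - s) * t = u := by field_simp; ring
      rw [hu] at h3
      have ha : 0 < (t - u) / (t - s) := div_pos (by linarith) hts
      have hb : 0 < (u - s) / (t - s) := div_pos (by linarith) hts
      have hab : (t - u) / (t - s) + (u - s) / (t - s) = 1 := by field_simp; ring
      generalize (t - u) / (t - s) = a at *
      generalize (u - s) / (t - s) = b at *
      have h4 : A * Real.exp (-(c * u)) = 
          (A * Real.exp (-(c * s))) ^ a * (A * Real.exp (-(c * t))) ^ b := by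
        rw [Real.mul_rpow hA.le (Real.exp_pos _).le, Real.mul_rpow hA.le (Real.exp_pos _).le,
          ← Real.exp_mul, ← Real.exp_mul, mul_mul_mul_comm, ← Real.rpow_add hA, hab, Real.rpow_one,
          ← Real.exp_add, ← hu]
        congr 2; ring
      have h5 : (A * Real.exp (-(c * s))) ^ a * (A * Real.exp (-(c * t))) ^ b < h s ^ a * h t ^ b := by
        apply mul_lt_mul'' (Real.rpow_lt_rpow (by positivity) (by linarith) ha) 
          (Real.rpow_lt_rpow (by positivity) (by linarith) hb) <;> positivity
      linarith)
    (by
      simp_rw [s0]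
      rw [integral_sub i0 (j0.const_mul A), integral_const_mul, g0, hAdef]
      change M0 - _ = 0
      field_simp; ring)
    (by
      simp_rw [s1]
      rw [integral_sub i1 (j1.const_mul A), integral_const_mul, g1, hAdef]
      change M1 - _ = 0
      field_simp
      rw [hcdef]; field_simp; ring)
  simp_rw [s2] at key
  rw [integral_sub i2 (j2.const_mul A), integral_const_mul, g2, hAdef] at key
  have key : M2 ≤ M0 * c ^ p / Real.Gamma p * ((p + 1) * p * Real.Gamma p / c ^ p / c ^ 2) := by
    simpa using key
  have e3 : M0 * c ^ p / Real.Gamma p * ((p + 1) * p * Real.Gamma p / c ^ p / c ^ 2) =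
      M0 * ((p + 1) * p) / c ^ 2 := by field_simp
  rw [e3] at key
  calc M0 * M2 ≤ M0 * (M0 * ((p + 1) * p) / c ^ 2) := by gcongr
    _ = _ := by rw [hcdef]; field_simp

section
variable {n : ℕ}

lemma rh_meas {Ω : Set (EuclideanSpace ℝ (Fin n))} (hΩo : IsOpen Ω)
    {φ : EuclideanSpace ℝ (Fin n) → ℝ} (hφ : ContinuousOn φ Ω) : Measurable (Ω.indicator φ) := by
  classical
  exact hφ.measurable_piecewise continuousOn_const hΩo.measurableSet

/-- the Laplace kernel -/
noncomputable def rhK (Ω : Set (EuclideanSpace ℝ (Fin n))) (φ : EuclideanSpace ℝ (Fin n) → ℝ)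
    (t : ℝ) (x : EuclideanSpace ℝ (Fin n)) : ℝ≥0∞ :=
  Ω.indicator (fun x => ENNReal.ofReal (Real.exp (-(φ x * t)))) x

lemma rhK_meas {Ω : Set (EuclideanSpace ℝ (Fin n))} (hΩo : IsOpen Ω)
    {φ : EuclideanSpace ℝ (Fin n) → ℝ} (hφ : ContinuousOn φ Ω) :
    Measurable (Function.uncurry (rhK Ω φ)) := by
  have : Function.uncurry (rhK Ω φ) = (Prod.snd ⁻¹' Ω : Set (ℝ × EuclideanSpace ℝ (Fin n))).indicator
      (fun z => ENNReal.ofReal (Real.exp (-(Ω.indicator φ z.2 * z.1)))) := by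
    ext ⟨t, x⟩
    by_cases hx : x ∈ Ω <;> simp [rhK, hx, indicator]
  rw [this]
  have := rh_meas hΩo hφ
  refine Measurable.indicator ?_ (measurable_snd hΩo.measurableSet)
  fun_prop

noncomputable def rhF (Ω : Set (EuclideanSpace ℝ (Fin n))) (φ : EuclideanSpace ℝ (Fin n) → ℝ)
    (t : ℝ) : ℝ≥0∞ := ∫⁻ x, rhK Ω φ t x

lemma rhF_meas {Ω : Set (EuclideanSpace ℝ (Fin n))} (hΩo : IsOpen Ω)
    {φ : EuclideanSpace ℝ (Fin n) → ℝ} (hφ : ContinuousOn φ Ω) :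
    Measurable (rhF Ω φ) := (rhK_meas hΩo hφ).lintegral_prod_right'

lemma rhF_scale {Ω : Set (EuclideanSpace ℝ (Fin n))} (hΩo : IsOpen Ω)
    {φ : EuclideanSpace ℝ (Fin n) → ℝ} (hφ : ContinuousOn φ Ω) {t : ℝ} (ht : 0 < t) :
    ∫⁻ y, rhK Ω φ t (t⁻¹ • y) = ENNReal.ofReal (t ^ n) * rhF Ω φ t := by
  have hm : Measurable (rhK Ω φ t) := (rhK_meas hΩo hφ).comp measurable_prodMk_left
  rw [← lintegral_map hm (measurable_const_smul t⁻¹), 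
    Measure.map_addHaar_smul volume (inv_ne_zero ht.ne'), lintegral_smul_measure, rhF]
  simp [abs_of_pos ht]

lemma rhF_logconc {Ω : Set (EuclideanSpace ℝ (Fin n))} (hΩo : IsOpen Ω)
    {φ : EuclideanSpace ℝ (Fin n) → ℝ} (hφ : ConvexOn ℝ Ω φ) {s t a b : ℝ} (hs : 0 < s) (ht : 0 < t)
    (ha : 0 < a) (hb : 0 < b) (hab : a + b = 1) :
    (ENNReal.ofReal (s ^ n) * rhF Ω φ s) ^ a * (ENNReal.ofReal (t ^ n) * rhF Ω φ t) ^ b ≤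
      ENNReal.ofReal ((a * s + b * t) ^ n) * rhF Ω φ (a * s + b * t) := by
  have hcont := hφ.continuousOn hΩo
  have hu : 0 < a * s + b * t := by positivity
  have hm : ∀ t, Measurable (rhK Ω φ t) := fun t => (rhK_meas hΩo hcont).comp measurable_prodMk_left
  rw [← rhF_scale hΩo hcont hs, ← rhF_scale hΩo hcont ht, ← rhF_scale hΩo hcont hu]
  refine rh_pl_euclidean n a b ha hb hab _ _ _ ((hm s).comp (measurable_const_smul _))
    ((hm t).comp (measurable_const_smul _)) ((hm _).comp (measurable_const_smul _)) fun y z => ?_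
  by_cases hy : s⁻¹ • y ∈ Ω
  swap
  · simp [rhK, hy, ha]
  by_cases hz : t⁻¹ • z ∈ Ω
  swap
  · simp [rhK, hz, hb]
  generalize huv : a * s + b * t = u at *
  have e : u⁻¹ • (a • y + b • z) = (a * s / u) • (s⁻¹ • y) + (b * t / u) • (t⁻¹ • z) := by
    simp only [smul_add, smul_smul]
    congr 2 <;> field_simp
  have h1 : 0 ≤ a * s / u := by positivity
  have h2 : 0 ≤ b * t / u := by positivity
  have h3 : a * s / u + b * t / u = 1 := by rw [← add_div, huv, div_self hu.ne']
  have hin := hφ.1 hy hz h1 h2 h3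
  have hcv := hφ.2 hy hz h1 h2 h3
  rw [← e] at hin hcv
  simp only [rhK, indicator_of_mem hin, indicator_of_mem hy, indicator_of_mem hz]
  rw [ENNReal.ofReal_rpow_of_pos (Real.exp_pos _), ENNReal.ofReal_rpow_of_pos (Real.exp_pos _),
    ← ENNReal.ofReal_mul (by positivity), ← Real.exp_mul, ← Real.exp_mul, ← Real.exp_add]
  apply ENNReal.ofReal_le_ofReal
  apply Real.exp_le_exp.2
  have h5 := mul_le_mul_of_nonneg_right hcv hu.le
  have h6 : (a * s / u) • φ (s⁻¹ • y) + (b * t / u) • φ (t⁻¹ • z) = 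
    (a * s * φ (s⁻¹ • y) + b * t * φ (t⁻¹ • z)) / u := by
    simp only [smul_eq_mul]; ring
  rw [h6, div_mul_cancel₀ _ hu.ne'] at h5
  linarith

lemma rhF_tonelli {Ω : Set (EuclideanSpace ℝ (Fin n))} (hΩo : IsOpen Ω)
    {φ : EuclideanSpace ℝ (Fin n) → ℝ} (hφ : ContinuousOn φ Ω) (hpos : ∀ x ∈ Ω, 0 < φ x)
    {q : ℝ} (hq : 0 < q) :
    ∫⁻ t in Ioi 0, ENNReal.ofReal (t ^ (q - 1)) * rhF Ω φ t = 
      ENNReal.ofReal (Real.Gamma q) * ∫⁻ x in Ω, ENNReal.ofReal (φ x ^ (-q)) := by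
  have hK := rhK_meas hΩo hφ
  have hm : ∀ t, Measurable (rhK Ω φ t) := fun t => hK.comp measurable_prodMk_left
  simp_rw [rhF, ← lintegral_const_mul _ (hm _)]
  rw [lintegral_lintegral_swap, ← lintegral_indicator hΩo.measurableSet, 
    ← lintegral_const_mul' _ _ ENNReal.ofReal_ne_top]
  swap
  · have : Measurable fun z : ℝ × EuclideanSpace ℝ (Fin n) => 
      ENNReal.ofReal (z.1 ^ (q - 1)) * Function.uncurry (rhK Ω φ) z := by fun_prop
    exact this.aemeasurable
  refine lintegral_congr fun x => ?_
  by_cases hx : x ∈ Ω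
  · simp only [rhK, indicator_of_mem hx]
    have hx0 := hpos x hx
    rw [← ENNReal.ofReal_mul (Real.Gamma_pos_of_pos hq).le]
    have := Real.integral_rpow_mul_exp_neg_mul_Ioi hq hx0
    rw [one_div, Real.inv_rpow hx0.le, ← Real.rpow_neg hx0.le, mul_comm] at this
    rw [← this, ofReal_integral_eq_lintegral_ofReal (rh_gamma hq hx0)]
    · refine setLIntegral_congr_fun measurableSet_Ioi fun t ht => ?_
      rw [ENNReal.ofReal_mul (Real.rpow_nonneg (le_of_lt ht) _)]
    · filter_upwards [ae_restrict_mem measurableSet_Ioi] with t ht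
      exact mul_nonneg (Real.rpow_nonneg (le_of_lt ht) _) (Real.exp_pos _).le
  · simp [rhK, hx]

lemma rhF_ne_top {Ω : Set (EuclideanSpace ℝ (Fin n))} (hΩo : IsOpen Ω)
    {φ : EuclideanSpace ℝ (Fin n) → ℝ} (hφ : ContinuousOn φ Ω) (hpos : ∀ x ∈ Ω, 0 < φ x)
    {q : ℝ} (hq : 0 < q) (hi : IntegrableOn (fun x => φ x ^ (-q)) Ω) {t : ℝ} (ht : 0 < t) :
    rhF Ω φ t ≠ ∞ := by
  have h1 := rhF_tonelli hΩo hφ hpos hq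
  have hfin : ∫⁻ x in Ω, ENNReal.ofReal (φ x ^ (-q)) < ∞ := hi.lintegral_lt_top
  have h2 : ∫⁻ t in Ioi 0, ENNReal.ofReal (t ^ (q - 1)) * rhF Ω φ t ≠ ∞ := by
    rw [h1]; exact ENNReal.mul_ne_top ENNReal.ofReal_ne_top hfin.ne
  have hF := rhF_meas hΩo hφ
  have h3 := ae_lt_top (by fun_prop) h2
  rw [ae_restrict_iff' measurableSet_Ioi] at h3
  have h4 : ∃ s ∈ Ioo 0 t, ENNReal.ofReal (s ^ (q - 1)) * rhF Ω φ s < ∞ := by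
    by_contra hcon
    push Not at hcon
    have h5 : volume (Ioo 0 t) = 0 := by
      refine measure_mono_null ?_ h3
      intro s hs hh
      exact absurd (hh hs.1) (not_lt.2 (hcon s hs))
    simp at h5
    linarith
  obtain ⟨s, hs, hs2⟩ := h4
  have h6 : rhF Ω φ s ≠ ∞ := by
    intro h
    rw [h, ENNReal.mul_top] at hs2
    · exact lt_irrefl _ hs2
    · simpa using Real.rpow_pos_of_pos hs.1 _
  refine ne_top_of_le_ne_top h6 (lintegral_mono fun x => ?_)
  by_cases hx : x ∈ Ω
  · simp only [rhK, indicator_of_mem hx]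
    apply ENNReal.ofReal_le_ofReal
    apply Real.exp_le_exp.2
    have := hpos x hx
    nlinarith [hs.2]
  · simp [rhK, hx]

lemma rhF_pos {Ω : Set (EuclideanSpace ℝ (Fin n))} (hΩo : IsOpen Ω)
    {φ : EuclideanSpace ℝ (Fin n) → ℝ} (hφ : ContinuousOn φ Ω) (hne : Ω.Nonempty) (t : ℝ) :
    0 < rhF Ω φ t := by
  have hm : Measurable (rhK Ω φ t) := (rhK_meas hΩo hφ).comp measurable_prodMk_left
  rw [rhF, lintegral_pos_iff_support hm]
  refine lt_of_lt_of_le (hΩo.measure_pos volume hne) (measure_mono fun x hx => ?_)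
  simp [rhK, hx, Real.exp_pos]

lemma rhF_moment {Ω : Set (EuclideanSpace ℝ (Fin n))} (hΩo : IsOpen Ω)
    {φ : EuclideanSpace ℝ (Fin n) → ℝ} (hφ : ContinuousOn φ Ω) (hpos : ∀ x ∈ Ω, 0 < φ x)
    {q : ℝ} (hq : 0 < q) (hi : IntegrableOn (fun x => φ x ^ (-q)) Ω) :
    IntegrableOn (fun t => t ^ (q - 1) * (rhF Ω φ t).toReal) (Ioi 0) ∧
    ∫ t in Ioi 0, t ^ (q - 1) * (rhF Ω φ t).toReal = Real.Gamma q * ∫ x in Ω, φ x ^ (-q) := by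
  have hF := rhF_meas hΩo hφ
  have hnn : 0 ≤ᵐ[volume.restrict (Ioi 0)] fun t => t ^ (q - 1) * (rhF Ω φ t).toReal := by
    filter_upwards [ae_restrict_mem measurableSet_Ioi] with t ht
    exact mul_nonneg (Real.rpow_nonneg (le_of_lt ht) _) ENNReal.toReal_nonneg
  have hnn2 : 0 ≤ᵐ[volume.restrict Ω] fun x => φ x ^ (-q) := by
    filter_upwards [ae_restrict_mem hΩo.measurableSet] with x hx
    exact Real.rpow_nonneg (hpos x hx).le _
  have e : ∫⁻ t in Ioi 0, ENNReal.ofReal (t ^ (q - 1) * (rhF Ω φ t).toReal) = 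
      ENNReal.ofReal (Real.Gamma q * ∫ x in Ω, φ x ^ (-q)) := by
    rw [ENNReal.ofReal_mul (Real.Gamma_pos_of_pos hq).le, 
      ofReal_integral_eq_lintegral_ofReal hi hnn2, ← rhF_tonelli hΩo hφ hpos hq]
    refine setLIntegral_congr_fun measurableSet_Ioi fun t ht => ?_
    rw [ENNReal.ofReal_mul (Real.rpow_nonneg (le_of_lt ht) _), 
      ENNReal.ofReal_toReal (rhF_ne_top hΩo hφ hpos hq hi ht)]
  have hmeas : Measurable fun t : ℝ => t ^ (q - 1) * (rhF Ω φ t).toReal := by fun_prop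
  constructor
  · refine (lintegral_ofReal_ne_top_iff_integrable hmeas.aestronglyMeasurable hnn).1 ?_
    rw [e]; exact ENNReal.ofReal_ne_top
  · rw [integral_eq_lintegral_of_nonneg_ae hnn hmeas.aestronglyMeasurable, e, ENNReal.toReal_ofReal]
    exact mul_nonneg (Real.Gamma_pos_of_pos hq).le (integral_nonneg_of_ae hnn2)

end

theorem reverse_holder_convex (n : ℕ) (Ω : Set (EuclideanSpace ℝ (Fin n)))
    (hΩo : IsOpen Ω) (hΩc : Convex ℝ Ω)
    (φ : EuclideanSpace ℝ (Fin n) → ℝ) (hφ : ConvexOn ℝ Ω φ)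
    (hpos : ∀ x ∈ Ω, 0 < φ x) (β : ℝ) (hβ : β > n)
    (h1 : IntegrableOn (fun x => φ x ^ (-β)) Ω)
    (h2 : IntegrableOn (fun x => φ x ^ (-β - 2)) Ω)
    (h3 : IntegrableOn (fun x => φ x ^ (-β - 1)) Ω) :
    (∫ x in Ω, φ x ^ (-β)) * (∫ x in Ω, φ x ^ (-β - 2)) ≤
      (β * (β - n + 1)) / ((β + 1) * (β - n)) * (∫ x in Ω, φ x ^ (-β - 1)) ^ 2 := by
  rcases Ω.eq_empty_or_nonempty with rfl | hne
  · simp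
  have hcont := hφ.continuousOn hΩo
  have hβ0 : 0 < β := lt_of_le_of_lt (Nat.cast_nonneg n) hβ
  have hp : 0 < β - n := by linarith
  rw [show -β - 2 = -(β + 2) by ring] at *
  rw [show -β - 1 = -(β + 1) by ring] at *
  obtain ⟨i0, m0⟩ := rhF_moment hΩo hcont hpos hβ0 h1
  obtain ⟨i1, m1⟩ := rhF_moment hΩo hcont hpos (by linarith : 0 < β + 1) h3
  obtain ⟨i2, m2⟩ := rhF_moment hΩo hcont hpos (by linarith : 0 < β + 2) h2
  have e0 : EqOn (fun t => t ^ (β - 1) * (rhF Ω φ t).toReal) 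
      (fun t => t ^ (β - n - 1) * (t ^ n * (rhF Ω φ t).toReal)) (Ioi 0) := by
    intro t ht
    simp only
    rw [show β - 1 = (β - n - 1) + n by ring, Real.rpow_add ht, Real.rpow_natCast]; ring
  have e1 : EqOn (fun t => t ^ (β + 1 - 1) * (rhF Ω φ t).toReal) 
      (fun t => t ^ (β - n - 1) * (t * (t ^ n * (rhF Ω φ t).toReal))) (Ioi 0) := by
    intro t ht
    simp only
    rw [show β + 1 - 1 = (β - n - 1) + n + 1 by ring, Real.rpow_add ht, Real.rpow_add ht, 
      Real.rpow_natCast, Real.rpow_one]; ring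
  have e2 : EqOn (fun t => t ^ (β + 2 - 1) * (rhF Ω φ t).toReal) 
      (fun t => t ^ (β - n - 1) * (t ^ 2 * (t ^ n * (rhF Ω φ t).toReal))) (Ioi 0) := by
    intro t ht
    simp only
    rw [show β + 2 - 1 = (β - n - 1) + n + 2 by ring, Real.rpow_add ht, Real.rpow_add ht, 
      Real.rpow_natCast, Real.rpow_two]; ring
  have key := rh_moment hp (fun t => t ^ n * (rhF Ω φ t).toReal) 
    (fun t ht => mul_pos (by positivity) (ENNReal.toReal_pos (rhF_pos hΩo hcont hne t).ne' 
      (rhF_ne_top hΩo hcont hpos hβ0 h1 ht)))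
    (by
      intro s t hs ht a b ha hb hab
      have hu : 0 < a * s + b * t := by positivity
      have h := ENNReal.toReal_mono (ENNReal.mul_ne_top ENNReal.ofReal_ne_top 
        (rhF_ne_top hΩo hcont hpos hβ0 h1 hu)) (rhF_logconc hΩo hφ hs ht ha hb hab)
      simp only [ENNReal.toReal_mul, ← ENNReal.toReal_rpow] at h
      rwa [ENNReal.toReal_ofReal (by positivity), ENNReal.toReal_ofReal (by positivity),
        ENNReal.toReal_ofReal (by positivity)] at h)
    ((integrableOn_congr_fun e0 measurableSet_Ioi).1 i0)
    ((integrableOn_congr_fun e1 measurableSet_Ioi).1 i1)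
    ((integrableOn_congr_fun e2 measurableSet_Ioi).1 i2)
  rw [← setIntegral_congr_fun measurableSet_Ioi e0, ← setIntegral_congr_fun measurableSet_Ioi e1,
    ← setIntegral_congr_fun measurableSet_Ioi e2, m0, m1, m2, show β + 2 = (β + 1) + 1 by ring,
    Real.Gamma_add_one (by linarith), Real.Gamma_add_one hβ0.ne'] at key
  rw [show β + 1 + 1 = β + 2 by ring] at key
  have hG := Real.Gamma_pos_of_pos hβ0
  generalize Real.Gamma β = G at *
  generalize (∫ x in Ω, φ x ^ (-β)) = J0 at *
  generalize (∫ x in Ω, φ x ^ (-(β + 1))) = J1 at *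
  generalize (∫ x in Ω, φ x ^ (-(β + 2))) = J2 at *
  have hD : 0 < (β + 1) * β * G ^ 2 := by positivity
  refine le_of_mul_le_mul_left ?_ hD
  calc _ = G * J0 * ((β + 1) * (β * G) * J2) := by ring
    _ ≤ _ := key
    _ = _ := by field_simp
end

section
/- Let dμ = e^{-V(x)} dx be a log-concave probability measure on ℝ^n, i.e. V : ℝ^n → ℝ is convex and ∫ e^{-V} dx = 1, with V ∈ L²(μ). Then Var_μ(V) := ∫ V² dμ - (∫ V dμ)² ≤ n. -/
open MeasureTheory Set
open scoped ENNReal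

lemma bm_compact {K L C : Set ℝ} (hK : IsCompact K) (hL : IsCompact L) (hKn : K.Nonempty)
    (hLn : L.Nonempty) (h : ∀ x ∈ K, ∀ y ∈ L, (x + y) / 2 ∈ C) :
    volume K + volume L ≤ 2 * volume C := by
  obtain ⟨M, hM, hM'⟩ := hK.exists_isGreatest hKn
  obtain ⟨m, hm, hm'⟩ := hL.exists_isLeast hLn
  have hD : volume ((fun z : ℝ => 2⁻¹ * z) ⁻¹' C) = 2 * volume C := by
    rw [Real.volume_preimage_mul_left (by norm_num)]
    norm_num
  rw [← hD]
  have h1 : volume ((fun z : ℝ => z + -m) ⁻¹' K) = volume K := measure_preimage_add_right _ _ _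
  have h2 : volume ((fun z : ℝ => z + -M) ⁻¹' L) = volume L := measure_preimage_add_right _ _ _
  rw [← h1, ← h2, ← measure_union₀]
  · apply measure_mono
    rintro z (hz | hz)
    · have := h _ hz m hm
      simp only [mem_preimage] at *
      convert this using 1; ring
    · have := h M hM _ hz
      simp only [mem_preimage] at *
      convert this using 1; ring
  · apply MeasurableSet.nullMeasurableSet
    exact hL.measurableSet.preimage (measurable_id.add_const _)
  · apply measure_mono_null (t := {M + m})
    · rintro z ⟨hz1, hz2⟩
      have := hM' hz1
      have := hm' hz2
      simp only [mem_singleton_iff]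
      linarith
    · simp

lemma bm_one {A B C : Set ℝ} (hA : MeasurableSet A) (hB : MeasurableSet B) (hAn : A.Nonempty)
    (hBn : B.Nonempty) (h : ∀ x ∈ A, ∀ y ∈ B, (x + y) / 2 ∈ C) :
    volume A + volume B ≤ 2 * volume C := by
  obtain ⟨a, ha⟩ := hAn
  obtain ⟨b, hb⟩ := hBn
  rw [hA.measure_eq_iSup_isCompact, hB.measure_eq_iSup_isCompact]
  simp only [iSup_and']
  have key : ∀ K ⊆ A, IsCompact K → ∀ L ⊆ B, IsCompact L → volume K + volume L ≤ 2 * volume C := by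
    intro K hKA hK L hLB hL
    refine le_trans (add_le_add (measure_mono (subset_insert a K)) (measure_mono (subset_insert b L)))
      (bm_compact (hK.insert a) (hL.insert b) (insert_nonempty _ _) (insert_nonempty _ _) ?_)
    intro x hx y hy
    exact h x (insert_subset ha hKA hx) y (insert_subset hb hLB hy)
  exact ENNReal.biSup_add_biSup_le' ⟨∅, empty_subset _, isCompact_empty⟩
    ⟨∅, empty_subset _, isCompact_empty⟩ fun K hK L hL => key K hK.1 hK.2 L hL.1 hL.2

lemma pl_real {f g h : ℝ → ℝ} (hf : Measurable f) (hg : Measurable g) (hh : Measurable h)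
    (hf0 : ∀ x, 0 ≤ f x) (hg0 : ∀ x, 0 ≤ g x) (hh0 : ∀ x, 0 ≤ h x)
    (hf1 : ∀ x, f x ≤ 1) (hg1 : ∀ x, g x ≤ 1)
    (hfs : ∀ t < 1, ∃ x, t < f x) (hgs : ∀ t < 1, ∃ x, t < g x)
    (H : ∀ x y, f x * g y ≤ h ((x + y) / 2) ^ 2) :
    (∫⁻ x, ENNReal.ofReal (f x)) + ∫⁻ x, ENNReal.ofReal (g x) ≤ 2 * ∫⁻ x, ENNReal.ofReal (h x) := by
  rw [lintegral_eq_lintegral_meas_lt _ (ae_of_all _ hf0) hf.aemeasurable,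
    lintegral_eq_lintegral_meas_lt _ (ae_of_all _ hg0) hg.aemeasurable,
    lintegral_eq_lintegral_meas_lt _ (ae_of_all _ hh0) hh.aemeasurable,
    ← lintegral_const_mul' _ _ (by norm_num), ← lintegral_add_left]
  · apply setLIntegral_mono' measurableSet_Ioi
    intro t (ht : 0 < t)
    by_cases h1 : t < 1
    · apply bm_one (hf measurableSet_Ioi) (hg measurableSet_Ioi) (hfs t h1) (hgs t h1)
      intro x (hx : t < f x) y (hy : t < g y)
      change t < h _
      have := H x y
      have := hh0 ((x + y) / 2)
      by_contra! h3
      nlinarith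
    · have e1 : {a | t < f a} = ∅ := by
        ext x; simp; linarith [hf1 x]
      have e2 : {a | t < g a} = ∅ := by
        ext x; simp; linarith [hg1 x]
      simp [e1, e2]
  · apply Antitone.measurable
    intro s t hst
    exact measure_mono fun x (hx : t < f x) => lt_of_le_of_lt hst hx

lemma amgm (a b : ℝ≥0∞) : 4 * (a * b) ≤ (a + b) ^ 2 := by
  rcases eq_or_ne a ⊤ with rfl | ha
  · simp
  rcases eq_or_ne b ⊤ with rfl | hb
  · simp
  lift a to NNReal using ha
  lift b to NNReal using hb
  norm_cast
  rw [← NNReal.coe_le_coe]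
  push_cast
  nlinarith [sq_nonneg ((a:ℝ) - b)]

lemma pl_bdd {f g h : ℝ → ℝ≥0∞} (hf : Measurable f) (hg : Measurable g) (hh : Measurable h)
    (hft : (⨆ x, f x) ≠ ⊤) (hgt : (⨆ x, g x) ≠ ⊤)
    (H : ∀ x y, f x * g y ≤ h ((x + y) / 2) ^ 2) :
    (∫⁻ x, f x) * (∫⁻ x, g x) ≤ (∫⁻ x, h x) ^ 2 := by
  rcases eq_or_ne (⨆ x, f x) 0 with hA0 | hA0
  · have : ∀ x, f x = 0 := fun x => by simpa [hA0] using le_iSup f x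
    simp [this]
  rcases eq_or_ne (⨆ x, g x) 0 with hB0 | hB0
  · have : ∀ x, g x = 0 := fun x => by simpa [hB0] using le_iSup g x
    simp [this]
  obtain ⟨a, ha⟩ : ∃ a, a = (⨆ x, f x).toReal := ⟨_, rfl⟩
  obtain ⟨b, hb⟩ : ∃ b, b = (⨆ x, g x).toReal := ⟨_, rfl⟩
  have ha0 : 0 < a := ha ▸ ENNReal.toReal_pos hA0 hft
  have hb0 : 0 < b := hb ▸ ENNReal.toReal_pos hB0 hgt
  have hfx : ∀ x, f x ≠ ⊤ := fun x => ne_top_of_le_ne_top hft (le_iSup f x)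
  have hgx : ∀ x, g x ≠ ⊤ := fun x => ne_top_of_le_ne_top hgt (le_iSup g x)
  have hfa : ∀ x, (f x).toReal ≤ a := fun x => ha ▸ ENNReal.toReal_mono hft (le_iSup f x)
  have hgb : ∀ x, (g x).toReal ≤ b := fun x => hb ▸ ENNReal.toReal_mono hgt (le_iSup g x)
  obtain ⟨S, hS0, hS⟩ : ∃ S : ℝ, 0 < S ∧ S ^ 2 = a * b :=
    ⟨√(a * b), by positivity, Real.sq_sqrt (by positivity)⟩
  have hsup : ∀ (f : ℝ → ℝ≥0∞) (a : ℝ), (⨆ x, f x) ≠ ⊤ → a = (⨆ x, f x).toReal → 0 < a →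
      ∀ t < 1, ∃ x, t < (f x).toReal * a⁻¹ := by
    intro f a hft ha ha0 t ht
    by_contra! hc
    have h1 : (⨆ x, f x) ≤ ENNReal.ofReal (t * a) := by
      apply iSup_le
      intro x
      have hfx : f x ≠ ⊤ := ne_top_of_le_ne_top hft (le_iSup f x)
      rw [← ENNReal.ofReal_toReal hfx]
      apply ENNReal.ofReal_le_ofReal
      have := hc x
      rwa [← div_eq_mul_inv, div_le_iff₀ ha0] at this
    have h2 := ENNReal.toReal_mono ENNReal.ofReal_ne_top h1
    rw [← ha] at h2
    rcases le_total 0 (t * a) with h3 | h3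
    · rw [ENNReal.toReal_ofReal h3] at h2
      nlinarith
    · rw [ENNReal.ofReal_of_nonpos h3] at h2
      simp at h2; linarith
  have main := pl_real (f := fun x => (f x).toReal * a⁻¹) (g := fun x => (g x).toReal * b⁻¹)
    (h := fun x => (min (h x) (ENNReal.ofReal S)).toReal * S⁻¹) (by fun_prop) (by fun_prop)
    (by fun_prop) (fun x => by positivity) (fun x => by positivity) (fun x => by positivity)
    (fun x => by rw [← div_eq_mul_inv, div_le_one ha0]; exact hfa x)
    (fun x => by rw [← div_eq_mul_inv, div_le_one hb0]; exact hgb x)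
    (hsup f a hft ha ha0) (hsup g b hgt hb hb0) (by
      intro x y
      have h1 : (f x).toReal * (g y).toReal ≤ (min (h ((x+y)/2)) (ENNReal.ofReal S)).toReal ^ 2 := by
        rcases le_total (h ((x+y)/2)) (ENNReal.ofReal S) with hle | hle
        · rw [min_eq_left hle, ← ENNReal.toReal_mul, ← ENNReal.toReal_pow]
          exact ENNReal.toReal_mono
            (ENNReal.pow_ne_top (ne_top_of_le_ne_top ENNReal.ofReal_ne_top hle)) (H x y)
        · rw [min_eq_right hle, ENNReal.toReal_ofReal hS0.le, hS]
          exact mul_le_mul (hfa x) (hgb y) ENNReal.toReal_nonneg ha0.le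
      calc _ = (f x).toReal * (g y).toReal * (a * b)⁻¹ := by rw [mul_inv]; ring
        _ ≤ (min (h ((x+y)/2)) (ENNReal.ofReal S)).toReal ^ 2 * (a * b)⁻¹ := by gcongr
        _ = _ := by rw [← hS, mul_pow, inv_pow])
  have e1 : ∫⁻ x, ENNReal.ofReal ((f x).toReal * a⁻¹) = (∫⁻ x, f x) * ENNReal.ofReal a⁻¹ := by
    rw [← lintegral_mul_const' _ _ ENNReal.ofReal_ne_top]
    congr 1; ext x
    rw [ENNReal.ofReal_mul ENNReal.toReal_nonneg, ENNReal.ofReal_toReal (hfx x)]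
  have e2 : ∫⁻ x, ENNReal.ofReal ((g x).toReal * b⁻¹) = (∫⁻ x, g x) * ENNReal.ofReal b⁻¹ := by
    rw [← lintegral_mul_const' _ _ ENNReal.ofReal_ne_top]
    congr 1; ext x
    rw [ENNReal.ofReal_mul ENNReal.toReal_nonneg, ENNReal.ofReal_toReal (hgx x)]
  have e3 : ∫⁻ x, ENNReal.ofReal ((min (h x) (ENNReal.ofReal S)).toReal * S⁻¹)
      ≤ (∫⁻ x, h x) * ENNReal.ofReal S⁻¹ := by
    rw [← lintegral_mul_const' _ _ ENNReal.ofReal_ne_top]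
    apply lintegral_mono
    intro x
    beta_reduce
    rw [ENNReal.ofReal_mul ENNReal.toReal_nonneg, ENNReal.ofReal_toReal
      (ne_top_of_le_ne_top ENNReal.ofReal_ne_top (min_le_right _ _))]
    exact mul_le_mul_left (min_le_left _ _) _
  rw [e1, e2] at main
  have m2 := main.trans (mul_le_mul_right e3 2)
  have m3 := (amgm _ _).trans (pow_le_pow_left' m2 2)
  have hc : ENNReal.ofReal a⁻¹ * ENNReal.ofReal b⁻¹ = ENNReal.ofReal S⁻¹ ^ 2 := by
    rw [← ENNReal.ofReal_mul (by positivity), ← ENNReal.ofReal_pow (by positivity), inv_pow, hS,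
      mul_inv]
  have c0 : 4 * ENNReal.ofReal S⁻¹ ^ 2 ≠ 0 := by simp [hS0]
  have ct : 4 * ENNReal.ofReal S⁻¹ ^ 2 ≠ ⊤ :=
    ENNReal.mul_ne_top (by norm_num) (ENNReal.pow_ne_top ENNReal.ofReal_ne_top)
  rw [← ENNReal.mul_le_mul_iff_right c0 ct]
  calc _ = 4 * ((∫⁻ x, f x) * ENNReal.ofReal a⁻¹ * ((∫⁻ x, g x) * ENNReal.ofReal b⁻¹)) := by
        rw [← hc]; ring
    _ ≤ _ := m3
    _ = _ := by ring

lemma pl_one {f g h : ℝ → ℝ≥0∞} (hf : Measurable f) (hg : Measurable g) (hh : Measurable h)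
    (H : ∀ x y, f x * g y ≤ h ((x + y) / 2) ^ 2) :
    (∫⁻ x, f x) * (∫⁻ x, g x) ≤ (∫⁻ x, h x) ^ 2 := by
  have key : ∀ f : ℝ → ℝ≥0∞, Measurable f → ∫⁻ x, f x = ⨆ N : ℕ, ∫⁻ x, min (f x) N := by
    intro f hf
    rw [← lintegral_iSup]
    · congr 1
      ext x
      apply le_antisymm
      · apply le_of_forall_lt
        intro c hc
        obtain ⟨N, hN⟩ := ENNReal.exists_nat_gt (ne_top_of_lt hc)
        exact lt_of_lt_of_le (lt_min hc hN) (le_iSup (fun N : ℕ => min (f x) (N : ℝ≥0∞)) N)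
      · exact iSup_le fun N => min_le_left _ _
    · intro N
      fun_prop
    · intro N M hNM x
      exact min_le_min_left _ (by exact_mod_cast hNM)
  rw [key f hf, key g hg]
  simp only [ENNReal.iSup_mul, ENNReal.mul_iSup, iSup_le_iff]
  intro N M
  apply pl_bdd (by fun_prop) (by fun_prop) hh
  · exact ne_top_of_le_ne_top (ENNReal.natCast_ne_top _) (iSup_le fun x => min_le_right _ _)
  · exact ne_top_of_le_ne_top (ENNReal.natCast_ne_top _) (iSup_le fun x => min_le_right _ _)
  · intro x y
    exact le_trans (mul_le_mul' (min_le_left _ _) (min_le_left _ _)) (H x y)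

lemma pl_pi (n : ℕ) : ∀ {f g h : (Fin n → ℝ) → ℝ≥0∞}, Measurable f → Measurable g → Measurable h →
    (∀ x y, f x * g y ≤ h ((2⁻¹ : ℝ) • (x + y)) ^ 2) →
    (∫⁻ x, f x) * (∫⁻ x, g x) ≤ (∫⁻ x, h x) ^ 2 := by
  induction n with
  | zero =>
    intro f g h hf hg hh H
    rw [Measure.volume_pi_eq_dirac 0, lintegral_dirac, lintegral_dirac, lintegral_dirac]
    simpa using H 0 0
  | succ n ih =>
    intro f g h hf hg hh H
    have e : ∀ p, (MeasurableEquiv.piFinSuccAbove (fun _ : Fin (n+1) => ℝ) 0).symm p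
        = Fin.cons p.1 p.2 := by
      intro p
      simp [MeasurableEquiv.piFinSuccAbove, Fin.insertNthEquiv]
    have key : ∀ f : (Fin (n+1) → ℝ) → ℝ≥0∞, Measurable f →
        ∫⁻ x, f x = ∫⁻ s : ℝ, ∫⁻ y : Fin n → ℝ, f (Fin.cons s y) := by
      intro f hf
      rw [← ((volume_preserving_piFinSuccAbove (fun _ : Fin (n+1) => ℝ) 0).symm).lintegral_comp_emb
        (MeasurableEquiv.measurableEmbedding _)]
      rw [Measure.volume_eq_prod, lintegral_prod]
      · simp only [e]
      · exact (hf.comp (MeasurableEquiv.measurable _)).aemeasurable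
    have hc : Measurable fun p : ℝ × (Fin n → ℝ) => (Fin.cons p.1 p.2 : Fin (n+1) → ℝ) := by
      simp only [← e]
      exact (MeasurableEquiv.piFinSuccAbove (fun _ : Fin (n+1) => ℝ) 0).symm.measurable
    have hm : ∀ f : (Fin (n+1) → ℝ) → ℝ≥0∞, Measurable f →
        Measurable fun s : ℝ => ∫⁻ y : Fin n → ℝ, f (Fin.cons s y) := by
      intro f hf
      exact (hf.comp hc).lintegral_prod_right'
    have hm2 : ∀ f : (Fin (n+1) → ℝ) → ℝ≥0∞, Measurable f → ∀ s : ℝ,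
        Measurable fun y : Fin n → ℝ => f (Fin.cons s y) := by
      intro f hf s
      exact (hf.comp hc).comp measurable_prodMk_left
    rw [key f hf, key g hg, key h hh]
    apply pl_one (hm f hf) (hm g hg) (hm h hh)
    intro s t
    apply ih (hm2 f hf s) (hm2 g hg t) (hm2 h hh _)
    intro x y
    convert H (Fin.cons s x) (Fin.cons t y) using 3
    ext i
    refine Fin.cases ?_ (fun j => ?_) i
    · simp; ring
    · simp; ring

lemma pl_euc (n : ℕ) {f g h : EuclideanSpace ℝ (Fin n) → ℝ≥0∞} (hf : Measurable f)
    (hg : Measurable g) (hh : Measurable h)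
    (H : ∀ x y, f x * g y ≤ h ((2⁻¹ : ℝ) • (x + y)) ^ 2) :
    (∫⁻ x, f x) * (∫⁻ x, g x) ≤ (∫⁻ x, h x) ^ 2 := by
  have hp := PiLp.volume_preserving_toLp (Fin n)
  rw [← hp.lintegral_comp hf, ← hp.lintegral_comp hg, ← hp.lintegral_comp hh]
  apply pl_pi n (hf.comp hp.measurable) (hg.comp hp.measurable) (hh.comp hp.measurable)
  intro x y
  exact H _ _

lemma scale (n : ℕ) {F : EuclideanSpace ℝ (Fin n) → ℝ≥0∞} (hF : Measurable F) {r : ℝ} (hr : 0 < r) :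
    ∫⁻ x, F (r⁻¹ • x) = ENNReal.ofReal (r ^ n) * ∫⁻ x, F x := by
  rw [← lintegral_map (f := F) (g := fun x => r⁻¹ • x) hF (by fun_prop),
    Measure.map_addHaar_smul _ (inv_ne_zero hr.ne'), lintegral_smul_measure]
  simp [abs_of_pos hr]

lemma exp_bound (u : ℝ) : 2 + u ^ 2 ≤ Real.exp u + Real.exp (-u) := by
  have h1 : Real.exp u + Real.exp (-u) = 2 + 4 * Real.sinh (u / 2) ^ 2 := by
    have := Real.cosh_sq (u / 2)
    have h2 := Real.cosh_two_mul (u / 2)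
    rw [show 2 * (u / 2) = u by ring, Real.cosh_eq] at h2
    linarith
  have h3 : |u / 2| ≤ |Real.sinh (u / 2)| := by
    rw [Real.abs_sinh]
    exact Real.self_le_sinh_iff.2 (abs_nonneg _)
  have := sq_le_sq.2 h3
  rw [h1]; nlinarith

lemma eps_ineq (n : ℕ) (V : EuclideanSpace ℝ (Fin n) → ℝ)
    (hV : ConvexOn ℝ Set.univ V)
    (hint : Integrable (fun x => Real.exp (-V x)))
    (hprob : ∫ x : EuclideanSpace ℝ (Fin n), Real.exp (-V x) = 1)
    (h1 : Integrable (fun x : EuclideanSpace ℝ (Fin n) => V x * Real.exp (-V x)))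
    (h2 : Integrable (fun x : EuclideanSpace ℝ (Fin n) => (V x) ^ 2 * Real.exp (-V x)))
    (ε : ℝ) (he0 : 0 < ε) (he1 : ε < 1) :
    (1 - ε ^ 2) ^ n * (1 + ε ^ 2 * ((∫ x : EuclideanSpace ℝ (Fin n), (V x) ^ 2 * Real.exp (-V x)) -
      (∫ x : EuclideanSpace ℝ (Fin n), V x * Real.exp (-V x)) ^ 2)) ≤ 1 := by
  have hc : Continuous V := hV.locallyLipschitz.continuous
  obtain ⟨M1, hM1⟩ : ∃ M, M = ∫ x : EuclideanSpace ℝ (Fin n), V x * Real.exp (-V x) := ⟨_, rfl⟩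
  obtain ⟨M2, hM2⟩ : ∃ M, M = ∫ x : EuclideanSpace ℝ (Fin n), (V x) ^ 2 * Real.exp (-V x) := ⟨_, rfl⟩
  rw [← hM1, ← hM2]
  let E : ℝ → EuclideanSpace ℝ (Fin n) → ℝ≥0∞ := fun r x => ENNReal.ofReal (Real.exp (-(r * V x)))
  have hE : ∀ r, Measurable (E r) := fun r => by
    have := hc.measurable
    fun_prop
  have ha : 0 < 1 + ε := by linarith
  have hb : 0 < 1 - ε := by linarith
  have hone : ∫⁻ x, E 1 x = 1 := by
    simp only [E, one_mul]
    rw [← ofReal_integral_eq_lintegral_ofReal hint (ae_of_all _ fun x => (Real.exp_pos _).le), hprob]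
    simp
  have PL := pl_euc n (f := fun x => E (1 + ε) ((1 + ε)⁻¹ • x))
    (g := fun x => E (1 - ε) ((1 - ε)⁻¹ • x)) (h := E 1)
    ((hE _).comp (by fun_prop)) ((hE _).comp (by fun_prop)) (hE _) (by
      intro x y
      simp only [E]
      rw [← ENNReal.ofReal_mul (Real.exp_pos _).le, ← ENNReal.ofReal_pow (Real.exp_pos _).le,
        ← Real.exp_add, ← Real.exp_nat_mul]
      apply ENNReal.ofReal_le_ofReal
      apply Real.exp_le_exp.2
      have := hV.2 (mem_univ ((1 + ε)⁻¹ • x)) (mem_univ ((1 - ε)⁻¹ • y))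
        (by linarith : 0 ≤ (1 + ε) / 2) (by linarith : 0 ≤ (1 - ε) / 2) (by ring)
      rw [smul_smul, smul_smul, show (1 + ε) / 2 * (1 + ε)⁻¹ = 2⁻¹ by field_simp,
        show (1 - ε) / 2 * (1 - ε)⁻¹ = 2⁻¹ by field_simp, ← smul_add] at this
      simp only [smul_eq_mul] at this
      push_cast
      linarith)
  rw [scale n (hE _) ha, scale n (hE _) hb, hone, one_pow] at PL
  have hne : ∀ r, ∫⁻ x, E r x ≠ 0 := by
    intro r h0
    rw [lintegral_eq_zero_iff (hE r)] at h0
    have : ∀ᵐ x : EuclideanSpace ℝ (Fin n), False := by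
      filter_upwards [h0] with x hx
      simp only [E, Pi.zero_apply, ENNReal.ofReal_eq_zero] at hx
      linarith [Real.exp_pos (-(r * V x))]
    simp only [Filter.eventually_false_iff_eq_bot, ae_eq_bot] at this
    rw [this] at hone
    simp at hone
  have hpt : ∫⁻ x, E (1 + ε) x ≠ ⊤ := by
    intro h
    rw [h, ENNReal.mul_top (by simp; positivity), ENNReal.top_mul] at PL
    · simp at PL
    · exact mul_ne_zero (by simp; positivity) (hne _)
  have hqt : ∫⁻ x, E (1 - ε) x ≠ ⊤ := by
    intro h
    rw [h, ENNReal.mul_top (by simp; positivity), ENNReal.mul_top] at PL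
    · simp at PL
    · exact mul_ne_zero (by simp; positivity) (hne _)
  have hI : ∀ r, ∫⁻ x, E r x ≠ ⊤ → Integrable fun x => Real.exp (-(r * V x)) := by
    intro r hr
    refine ⟨by fun_prop, ?_⟩
    rw [hasFiniteIntegral_iff_ofReal (ae_of_all _ fun x => (Real.exp_pos _).le)]
    exact lt_top_iff_ne_top.2 hr
  have hp := hI _ hpt
  have hq := hI _ hqt
  have hR : ∀ r, (∫⁻ x, E r x).toReal = ∫ x, Real.exp (-(r * V x)) := fun r => by
    rw [integral_eq_lintegral_of_nonneg_ae (ae_of_all _ fun x => (Real.exp_pos _).le) (by fun_prop)]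
  have PL' := ENNReal.toReal_mono (by simp) PL
  simp only [ENNReal.toReal_mul, hR] at PL'
  rw [ENNReal.toReal_ofReal (by positivity), ENNReal.toReal_ofReal (by positivity)] at PL'
  obtain ⟨p, hpd⟩ : ∃ M, M = ∫ x, Real.exp (-((1 + ε) * V x)) := ⟨_, rfl⟩
  obtain ⟨q, hqd⟩ : ∃ M, M = ∫ x, Real.exp (-((1 - ε) * V x)) := ⟨_, rfl⟩
  rw [← hpd, ← hqd] at PL'
  simp only [ENNReal.toReal_one] at PL'
  have pw : ∀ u v : ℝ, 2 * Real.exp (-v) * Real.exp (-u)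
      + ε ^ 2 * Real.exp (-v) * (u ^ 2 * Real.exp (-u))
      - 2 * ε ^ 2 * v * Real.exp (-v) * (u * Real.exp (-u))
      + ε ^ 2 * v ^ 2 * Real.exp (-v) * Real.exp (-u)
      ≤ Real.exp (-((1 - ε) * v)) * Real.exp (-((1 + ε) * u))
        + Real.exp (-((1 + ε) * v)) * Real.exp (-((1 - ε) * u)) := by
    intro u v
    have h := mul_le_mul_of_nonneg_left (exp_bound (ε * (v - u))) (Real.exp_pos (-v + -u)).le
    rw [mul_add (Real.exp _) (Real.exp _), ← Real.exp_add, ← Real.exp_add, Real.exp_add (-v) (-u)] at h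
    rw [← Real.exp_add, ← Real.exp_add]
    rw [show -((1 - ε) * v) + -((1 + ε) * u) = -v + -u + ε * (v - u) by ring,
      show -((1 + ε) * v) + -((1 - ε) * u) = -v + -u + -(ε * (v - u)) by ring]
    linarith
  have s1 : ∀ v : ℝ, 2 * Real.exp (-v) + ε ^ 2 * Real.exp (-v) * M2
      - 2 * ε ^ 2 * v * Real.exp (-v) * M1 + ε ^ 2 * v ^ 2 * Real.exp (-v)
      ≤ Real.exp (-((1 - ε) * v)) * p + Real.exp (-((1 + ε) * v)) * q := by
    intro v
    have i1 := hint.const_mul (2 * Real.exp (-v))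
    have i2 := h2.const_mul (ε ^ 2 * Real.exp (-v))
    have i3 := h1.const_mul (2 * ε ^ 2 * v * Real.exp (-v))
    have i4 := hint.const_mul (ε ^ 2 * v ^ 2 * Real.exp (-v))
    have i5 := hp.const_mul (Real.exp (-((1 - ε) * v)))
    have i6 := hq.const_mul (Real.exp (-((1 + ε) * v)))
    have h := integral_mono (((i1.add i2).sub i3).add i4) (i5.add i6) (fun x => pw (V x) v)
    rw [integral_add' ((i1.add i2).sub i3) i4, integral_sub' (i1.add i2) i3, integral_add' i1 i2,
      integral_add' i5 i6] at h
    simp only [integral_const_mul] at h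
    rw [hprob, ← hM1, ← hM2, ← hpd, ← hqd] at h
    simpa using h
  have s2 : 2 + ε ^ 2 * M2 - 2 * ε ^ 2 * M1 * M1 + ε ^ 2 * M2 ≤ p * q + q * p := by
    have i1 := hint.const_mul 2
    have i2 := hint.const_mul (ε ^ 2 * M2)
    have i3 := h1.const_mul (2 * ε ^ 2 * M1)
    have i4 := h2.const_mul (ε ^ 2)
    have i5 := hq.const_mul p
    have i6 := hp.const_mul q
    have h := integral_mono (((i1.add i2).sub i3).add i4) (i5.add i6) (fun x => by
      have := s1 (V x)
      simp only [Pi.add_apply, Pi.sub_apply]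
      linarith)
    rw [integral_add' ((i1.add i2).sub i3) i4, integral_sub' (i1.add i2) i3, integral_add' i1 i2,
      integral_add' i5 i6] at h
    simp only [integral_const_mul] at h
    rw [hprob, ← hM1, ← hM2, ← hpd, ← hqd] at h
    simpa using h
  calc _ ≤ (1 - ε ^ 2) ^ n * (p * q) := by
        apply mul_le_mul_of_nonneg_left
        · linarith
        · apply pow_nonneg; nlinarith
    _ = (1 + ε) ^ n * p * ((1 - ε) ^ n * q) := by
        rw [show 1 - ε ^ 2 = (1 + ε) * (1 - ε) by ring, mul_pow]; ring
    _ ≤ 1 := PL'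

theorem varianceV_le_dim (n : ℕ) (V : EuclideanSpace ℝ (Fin n) → ℝ)
    (hV : ConvexOn ℝ Set.univ V)
    (hint : Integrable (fun x => Real.exp (-V x)))
    (hprob : ∫ x : EuclideanSpace ℝ (Fin n), Real.exp (-V x) = 1)
    (h1 : Integrable (fun x : EuclideanSpace ℝ (Fin n) => V x * Real.exp (-V x)))
    (h2 : Integrable (fun x : EuclideanSpace ℝ (Fin n) => (V x) ^ 2 * Real.exp (-V x))) :
    (∫ x : EuclideanSpace ℝ (Fin n), (V x) ^ 2 * Real.exp (-V x)) -
      (∫ x : EuclideanSpace ℝ (Fin n), V x * Real.exp (-V x)) ^ 2 ≤ n := by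
  have key := eps_ineq n V hV hint hprob h1 h2
  generalize (∫ x : EuclideanSpace ℝ (Fin n), (V x) ^ 2 * Real.exp (-V x)) -
      (∫ x : EuclideanSpace ℝ (Fin n), V x * Real.exp (-V x)) ^ 2 = σ at key ⊢
  by_contra! hlt
  have hn : (0 : ℝ) ≤ n := Nat.cast_nonneg n
  have hσ : 0 < σ := by linarith
  obtain ⟨d, hd⟩ : ∃ d, d = σ - n := ⟨_, rfl⟩
  have hd0 : 0 < d := by linarith
  have hD : 0 < 2 * (n * σ + d) := by positivity
  obtain ⟨s, hs⟩ : ∃ s, s = d / (2 * (n * σ + d)) := ⟨_, rfl⟩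
  have hs0 : 0 < s := hs ▸ by positivity
  have hs' : s * (2 * (n * σ + d)) = d := by rw [hs]; field_simp
  have hs1 : s < 1 := by
    rw [hs, div_lt_one hD]
    have : 0 ≤ n * σ := by positivity
    linarith
  have k := key (√s) (Real.sqrt_pos.2 hs0) (by rw [Real.sqrt_lt' one_pos]; simpa using hs1)
  rw [Real.sq_sqrt hs0.le] at k
  have bern := one_add_mul_le_pow (a := -s) (by linarith) n
  have k2 : (1 + n * (-s)) * (1 + s * σ) ≤ 1 := by
    refine le_trans (mul_le_mul_of_nonneg_right bern (by positivity)) ?_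
    simpa [sub_eq_add_neg] using k
  have k3 : s * (σ - n - n * s * σ) ≤ 0 := by nlinarith
  have k4 : σ - n - n * s * σ ≤ 0 := by
    by_contra! h
    nlinarith [mul_pos hs0 h]
  have : 0 < s * d := by positivity
  nlinarith
end

section
/- Let φ : ℝ → (0,∞) be a C² convex function and β ≥ 2 such that μ(dx) = φ(x)^{-β} dx / ∫φ^{-β} is a probability measure on ℝ with φ'' > 0 everywhere. Then for every locally Lipschitz f ∈ L²(μ): Var_μ(f) ≤ (1/(β-1)) ∫ (f'(x))² φ(x)/φ''(x) dμ(x). -/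
open MeasureTheory

open Set Filter Topology in
/-- Key inequality on an interval on which the derivative of `φ` does not vanish. -/
lemma wbl_interval (φ : ℝ → ℝ) (hφC : ContDiff ℝ 2 φ) (hpos : ∀ x, 0 < φ x)
    (hφ'' : ∀ x, 0 < deriv (deriv φ) x) (β : ℝ)
    (f : ℝ → ℝ) (hf : LocallyLipschitz f) (c : ℝ)
    (hJ : Integrable (fun x => (deriv f x) ^ 2 * (φ x / deriv (deriv φ) x) * φ x ^ (-β)
      - (β - 1) * ((f x - c) ^ 2 * φ x ^ (-β))))
    (a b : ℝ) (hab : a ≤ b) (hne : ∀ x ∈ Icc a b, deriv φ x ≠ 0) :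
    φ b ^ (1 - β) / deriv φ b * (f b - c) ^ 2 - φ a ^ (1 - β) / deriv φ a * (f a - c) ^ 2 ≤
      ∫ x in a..b, ((deriv f x) ^ 2 * (φ x / deriv (deriv φ) x) * φ x ^ (-β)
      - (β - 1) * ((f x - c) ^ 2 * φ x ^ (-β))) := by
  have hφ' : ContDiff ℝ 1 (deriv φ) := by
    have : ContDiff ℝ (1 + 1) φ := by norm_num; exact hφC
    exact ((contDiff_succ_iff_deriv (n := 1)).1 this).2.2
  have hφd : Differentiable ℝ φ := hφC.differentiable (by norm_num)
  have hφ'd : Differentiable ℝ (deriv φ) := hφ'.differentiable (by norm_num)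
  have hP : AbsolutelyContinuousOnInterval (fun x => φ x ^ (1 - β) / deriv φ x) a b := by
    apply ContDiffOn.absolutelyContinuousOnInterval
    rw [uIcc_of_le hab]
    apply ContDiffOn.div
    · exact ((hφC.of_le (by norm_num)).contDiffOn).rpow_const_of_ne (fun x _ => (hpos x).ne')
    · exact hφ'.contDiffOn
    · exact hne
  have hfl : AbsolutelyContinuousOnInterval f a b := by
    obtain ⟨K, hK⟩ := (hf.locallyLipschitzOn (s := uIcc a b)).exists_lipschitzOnWith_of_compact
      isCompact_uIcc
    exact hK.absolutelyContinuousOnInterval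
  have hh : AbsolutelyContinuousOnInterval (fun x => f x - c) a b := by
    refine hfl.fun_sub ?_
    exact (contDiff_const (c := c)).contDiffOn.absolutelyContinuousOnInterval
  have hG : AbsolutelyContinuousOnInterval
      (fun x => φ x ^ (1 - β) / deriv φ x * (f x - c) ^ 2) a b := by
    have := hP.fun_mul (hh.fun_mul hh)
    simpa only [pow_two] using this
  rw [← hG.integral_deriv_eq_sub]
  apply intervalIntegral.integral_mono_ae_restrict hab hG.intervalIntegrable_deriv
    hJ.intervalIntegrable
  rw [EventuallyLE, ae_restrict_iff' measurableSet_Icc]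
  filter_upwards [hfl.ae_differentiableAt] with x hx hxI
  rw [uIcc_of_le hab] at hx
  have h1 := (hx hxI).hasDerivAt
  have h2 := (hφd x).hasDerivAt
  have h3 := (hφ'd x).hasDerivAt
  have hn := hne x hxI
  have h4 := ((h2.rpow_const (p := 1 - β) (Or.inl (hpos x).ne')).div h3 hn).mul
    ((h1.sub_const c).pow 2)
  have h5 : deriv (fun x => φ x ^ (1 - β) / deriv φ x * (f x - c) ^ 2) x = _ := h4.deriv
  rw [h5]
  have e1 : (1 - β - 1) = -β := by ring
  have e2 : φ x ^ (1 - β) = φ x * φ x ^ (-β) := by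
    rw [sub_eq_add_neg, Real.rpow_add (hpos x), Real.rpow_one]
  simp only [e1, e2, Pi.div_apply, Pi.pow_apply]
  have hw : 0 < φ x ^ (-β) := Real.rpow_pos_of_pos (hpos x) _
  have hp := hpos x
  have hq := hφ'' x
  generalize φ x ^ (-β) = w at *
  generalize deriv (deriv φ) x = q at *
  generalize deriv φ x = p at *
  generalize deriv f x = d at *
  generalize φ x = y at *
  generalize f x - c = h at *
  rw [← sub_nonneg]
  have : 0 ≤ y * w / q * (d - q * h / p) ^ 2 := by positivity
  convert this using 1
  push_cast
  field_simp
  ring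

open Set Filter Topology in
lemma wbl_crit (φ : ℝ → ℝ) (hφC : ContDiff ℝ 2 φ) (hpos : ∀ x, 0 < φ x)
    (β : ℝ) (hβ : 2 ≤ β) (hZint : Integrable (fun x => φ x ^ (-β))) :
    ∃ x₀, deriv φ x₀ = 0 := by
  by_contra! hne
  have hc : Continuous (deriv φ) := hφC.continuous_deriv (by norm_num)
  have hφd : Differentiable ℝ φ := hφC.differentiable (by norm_num)
  have key : ∀ s : Set ℝ, MeasurableSet s → volume s = ⊤ → ¬ (∀ x ∈ s, φ x ≤ φ 0) := by
    intro s hs hv hle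
    have h1 : IntegrableOn (fun _ : ℝ => φ 0 ^ (-β)) s := by
      refine Integrable.mono' hZint.integrableOn aestronglyMeasurable_const ?_
      refine (ae_restrict_iff' hs).2 (Eventually.of_forall fun x hx => ?_)
      rw [Real.norm_of_nonneg (Real.rpow_pos_of_pos (hpos 0) _).le]
      exact Real.rpow_le_rpow_of_nonpos (hpos x) (hle x hx) (by linarith)
    rw [integrableOn_const_iff (by simp)] at h1
    rcases h1 with h1 | h1
    · exact (Real.rpow_pos_of_pos (hpos 0) (-β)).ne' (by simpa using h1)
    · simp [hv] at h1
  rcases lt_or_gt_of_ne (hne 0) with h0 | h0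
  · have hneg : ∀ x, deriv φ x < 0 := by
      intro x
      by_contra! hx
      obtain ⟨y, hy⟩ := mem_range_of_exists_le_of_exists_ge hc ⟨0, h0.le⟩ ⟨x, hx⟩
      exact hne y hy
    have := strictAnti_of_deriv_neg hneg
    exact key (Ici 0) measurableSet_Ici (by simp) (fun x hx => this.antitone hx)
  · have hneg : ∀ x, 0 < deriv φ x := by
      intro x
      by_contra! hx
      obtain ⟨y, hy⟩ := mem_range_of_exists_le_of_exists_ge hc ⟨x, hx⟩ ⟨0, h0.le⟩
      exact hne y hy
    have := strictMono_of_deriv_pos hneg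
    exact key (Iic 0) measurableSet_Iic (by simp) (fun x hx => this.monotone hx)

open Set Filter Topology in
lemma wbl_lim (φ : ℝ → ℝ) (hφC : ContDiff ℝ 2 φ) (hpos : ∀ x, 0 < φ x)
    (hφ'' : ∀ x, 0 < deriv (deriv φ) x) (β : ℝ)
    (f : ℝ → ℝ) (hf : LocallyLipschitz f) (x₀ : ℝ) (h0 : deriv φ x₀ = 0) :
    Tendsto (fun x => φ x ^ (1 - β) / deriv φ x * (f x - f x₀) ^ 2) (𝓝[≠] x₀) (𝓝 0) := by
  have hφ' : ContDiff ℝ 1 (deriv φ) := by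
    have : ContDiff ℝ (1 + 1) φ := by norm_num; exact hφC
    exact ((contDiff_succ_iff_deriv (n := 1)).1 this).2.2
  have hφ'd : Differentiable ℝ (deriv φ) := hφ'.differentiable (by norm_num)
  have h1 : Tendsto (slope (deriv φ) x₀) (𝓝[≠] x₀) (𝓝 (deriv (deriv φ) x₀)) :=
    (hasDerivAt_iff_tendsto_slope).1 (hφ'd x₀).hasDerivAt
  have h2 : Tendsto (fun x => φ x ^ (1 - β)) (𝓝[≠] x₀) (𝓝 (φ x₀ ^ (1 - β))) :=
    ((hφC.continuous.continuousAt (x := x₀)).rpow_const (Or.inl (hpos x₀).ne')).tendsto.mono_left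
      nhdsWithin_le_nhds
  have h3 : Tendsto (fun x => |x - x₀|) (𝓝[≠] x₀) (𝓝 0) := by
    have : Continuous (fun x : ℝ => |x - x₀|) := by fun_prop
    have := (this.tendsto x₀).mono_left (nhdsWithin_le_nhds (s := {x₀}ᶜ))
    simpa using this
  obtain ⟨K, t, ht, hK⟩ := hf x₀
  have h4 : Tendsto (fun x => φ x ^ (1 - β) * |slope (deriv φ) x₀ x|⁻¹ * ((K:ℝ) ^ 2 * |x - x₀|))
      (𝓝[≠] x₀) (𝓝 0) := by
    have := (h2.mul (h1.abs.inv₀ (by simpa using (hφ'' x₀).ne'))).mul (h3.const_mul ((K:ℝ)^2))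
    simpa using this
  refine squeeze_zero_norm' ?_ h4
  filter_upwards [nhdsWithin_le_nhds ht, self_mem_nhdsWithin] with x hx hxne
  have hxne : x ≠ x₀ := hxne
  have h5 := hK.dist_le_mul x hx x₀ (mem_of_mem_nhds ht)
  rw [Real.dist_eq, Real.dist_eq] at h5
  have hw : 0 < φ x ^ (1-β) := Real.rpow_pos_of_pos (hpos x) _
  have h6 : |x - x₀| ≠ 0 := abs_ne_zero.2 (sub_ne_zero.2 hxne)
  have h7 : 0 < |x - x₀| := abs_pos.2 (sub_ne_zero.2 hxne)
  rw [slope_def_field, h0, sub_zero, norm_mul, norm_div, Real.norm_of_nonneg hw.le, norm_pow,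
    Real.norm_eq_abs, Real.norm_eq_abs, abs_div, inv_div]
  have h8 : |f x - f x₀| ^ 2 ≤ (K * |x - x₀|) ^ 2 := by gcongr
  calc φ x ^ (1 - β) / |deriv φ x| * |f x - f x₀| ^ 2
      ≤ φ x ^ (1 - β) / |deriv φ x| * (K * |x - x₀|) ^ 2 := by gcongr
    _ = _ := by ring

open Set Filter Topology in
lemma wbl_core (φ : ℝ → ℝ) (hφC : ContDiff ℝ 2 φ) (hpos : ∀ x, 0 < φ x)
    (hφ'' : ∀ x, 0 < deriv (deriv φ) x) (β : ℝ)
    (f : ℝ → ℝ) (hf : LocallyLipschitz f) (x₀ : ℝ) (h0 : deriv φ x₀ = 0)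
    (hJ : Integrable (fun x => (deriv f x) ^ 2 * (φ x / deriv (deriv φ) x) * φ x ^ (-β)
      - (β - 1) * ((f x - f x₀) ^ 2 * φ x ^ (-β)))) :
    0 ≤ ∫ x, ((deriv f x) ^ 2 * (φ x / deriv (deriv φ) x) * φ x ^ (-β)
      - (β - 1) * ((f x - f x₀) ^ 2 * φ x ^ (-β))) := by
  have hlim := wbl_lim φ hφC hpos hφ'' β f hf x₀ h0
  have hint := wbl_interval φ hφC hpos hφ'' β f hf (f x₀) hJ
  set J := (fun x => (deriv f x) ^ 2 * (φ x / deriv (deriv φ) x) * φ x ^ (-β)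
      - (β - 1) * ((f x - f x₀) ^ 2 * φ x ^ (-β))) with hJdef
  set G := (fun x => φ x ^ (1 - β) / deriv φ x * (f x - f x₀) ^ 2) with hGdef
  have hint' : ∀ a b, a ≤ b → (∀ x ∈ Icc a b, deriv φ x ≠ 0) → G b - G a ≤ ∫ x in a..b, J x := hint
  have hmono : StrictMono (deriv φ) := strictMono_of_deriv_pos hφ''
  have hw : ∀ x, 0 < φ x ^ (1-β) := fun x => Real.rpow_pos_of_pos (hpos x) _
  have hR : ∀ b, x₀ < b → 0 ≤ ∫ x in x₀..b, J x := by
    intro b hb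
    have hGb : 0 ≤ G b := by
      have h1 : 0 < deriv φ b := h0 ▸ hmono hb
      have := hw b
      simp only [hGdef]; positivity
    have hc : Continuous (fun a => ∫ x in b..a, J x) :=
      intervalIntegral.continuous_primitive (fun _ _ => hJ.intervalIntegrable) b
    have ht : Tendsto (fun a => G a + ∫ x in a..b, J x) (𝓝[>] x₀) (𝓝 (0 + ∫ x in x₀..b, J x)) := by
      refine (hlim.mono_left (nhdsWithin_mono _ (fun x hx => ne_of_gt hx))).add ?_
      simp_rw [intervalIntegral.integral_symm b]
      exact (hc.tendsto x₀).neg.mono_left nhdsWithin_le_nhds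
    rw [zero_add] at ht
    refine ge_of_tendsto ht ?_
    filter_upwards [Ioo_mem_nhdsGT hb] with a ha
    have := hint' a b ha.2.le (fun x hx => (h0 ▸ hmono (ha.1.trans_le hx.1) : 0 < deriv φ x).ne')
    linarith
  have hL : ∀ a, a < x₀ → 0 ≤ ∫ x in a..x₀, J x := by
    intro a ha
    have hGa : G a ≤ 0 := by
      have h1 : deriv φ a < 0 := h0 ▸ hmono ha
      exact mul_nonpos_of_nonpos_of_nonneg (div_nonpos_of_nonneg_of_nonpos (hw a).le h1.le)
        (sq_nonneg _)
    have hc : Continuous (fun b => ∫ x in a..b, J x) :=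
      intervalIntegral.continuous_primitive (fun _ _ => hJ.intervalIntegrable) a
    have ht : Tendsto (fun b => (∫ x in a..b, J x) - G b) (𝓝[<] x₀)
        (𝓝 ((∫ x in a..x₀, J x) - 0)) := by
      refine Tendsto.sub ?_ (hlim.mono_left (nhdsWithin_mono _ (fun x hx => ne_of_lt hx)))
      exact (hc.tendsto x₀).mono_left nhdsWithin_le_nhds
    rw [sub_zero] at ht
    refine ge_of_tendsto ht ?_
    filter_upwards [Ioo_mem_nhdsLT ha] with b hb
    have := hint' a b hb.1.le (fun x hx => (h0 ▸ hmono (hx.2.trans_lt hb.2) : deriv φ x < 0).ne)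
    linarith
  have ht := intervalIntegral_tendsto_integral hJ
    (tendsto_neg_atTop_atBot) (tendsto_id (α := ℝ) (x := atTop))
  refine ge_of_tendsto ht ?_
  filter_upwards [eventually_gt_atTop x₀, eventually_gt_atTop (-x₀)] with r h1 h2
  rw [← intervalIntegral.integral_add_adjacent_intervals (b := x₀) hJ.intervalIntegrable
    hJ.intervalIntegrable]
  exact add_nonneg (hL _ (by linarith)) (hR _ h1)

theorem weighted_brascamp_lieb_dim_one (φ : ℝ → ℝ) (hφC : ContDiff ℝ 2 φ)
    (hconv : ConvexOn ℝ Set.univ φ) (hpos : ∀ x, 0 < φ x)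
    (hφ'' : ∀ x, 0 < deriv (deriv φ) x)
    (β : ℝ) (hβ : 2 ≤ β)
    (hZint : Integrable (fun x => φ x ^ (-β)))
    (Z : ℝ) (hZ : Z = ∫ x, φ x ^ (-β))
    (f : ℝ → ℝ) (hf : LocallyLipschitz f)
    (hf2 : Integrable (fun x => (f x) ^ 2 * (φ x ^ (-β) / Z)))
    (hf1 : Integrable (fun x => f x * (φ x ^ (-β) / Z)))
    (hrhs : Integrable (fun x =>
      (deriv f x) ^ 2 * (φ x / deriv (deriv φ) x) * (φ x ^ (-β) / Z))) :
    (∫ x, (f x) ^ 2 * (φ x ^ (-β) / Z)) - (∫ x, f x * (φ x ^ (-β) / Z)) ^ 2 ≤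
      (1 / (β - 1)) *
        ∫ x, (deriv f x) ^ 2 * (φ x / deriv (deriv φ) x) * (φ x ^ (-β) / Z) := by
  obtain ⟨x₀, h0⟩ := wbl_crit φ hφC hpos β hβ hZint
  have hw : ∀ x, 0 < φ x ^ (-β) := fun x => Real.rpow_pos_of_pos (hpos x) _
  have hZpos : 0 < Z := by
    rw [hZ, integral_pos_iff_support_of_nonneg (fun x => (hw x).le) hZint]
    have : Function.support (fun x => φ x ^ (-β)) = Set.univ := by
      ext x; simp [(hw x).ne']
    rw [this]; simp
  have hm : Integrable (fun x => φ x ^ (-β) / Z) := hZint.div_const Z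
  have hm1 : ∫ x, φ x ^ (-β) / Z = 1 := by
    rw [integral_div, ← hZ, div_self hZpos.ne']
  set c := f x₀ with hc
  have hsqeq : (fun x => (f x - c) ^ 2 * (φ x ^ (-β) / Z)) = fun x =>
      (f x) ^ 2 * (φ x ^ (-β) / Z) - 2 * c * (f x * (φ x ^ (-β) / Z))
        + c ^ 2 * (φ x ^ (-β) / Z) := by
    ext x; ring
  have hsq : Integrable (fun x => (f x - c) ^ 2 * (φ x ^ (-β) / Z)) := by
    rw [hsqeq]
    exact (hf2.sub (hf1.const_mul _)).add (hm.const_mul _)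
  have hsqv : ∫ x, (f x - c) ^ 2 * (φ x ^ (-β) / Z) =
      (∫ x, (f x) ^ 2 * (φ x ^ (-β) / Z)) - 2 * c * (∫ x, f x * (φ x ^ (-β) / Z)) + c ^ 2 := by
    have hA : Integrable (fun x => (f x) ^ 2 * (φ x ^ (-β) / Z)
        - 2 * c * (f x * (φ x ^ (-β) / Z))) := hf2.sub (hf1.const_mul _)
    rw [hsqeq, integral_add hA (hm.const_mul _), integral_sub hf2 (hf1.const_mul _), integral_const_mul, integral_const_mul, hm1, mul_one]
  have hJeq : (fun x => (deriv f x) ^ 2 * (φ x / deriv (deriv φ) x) * φ x ^ (-β)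
      - (β - 1) * ((f x - c) ^ 2 * φ x ^ (-β))) = fun x => Z *
      ((deriv f x) ^ 2 * (φ x / deriv (deriv φ) x) * (φ x ^ (-β) / Z)
      - (β - 1) * ((f x - c) ^ 2 * (φ x ^ (-β) / Z))) := by
    ext x
    have : φ x ^ (-β) = Z * (φ x ^ (-β) / Z) := by field_simp
    generalize φ x ^ (-β) / Z = m at *
    rw [this]; ring
  have hJ := wbl_core φ hφC hpos hφ'' β f hf x₀ h0
    (by rw [← hc, hJeq]; exact (hrhs.sub (hsq.const_mul _)).const_mul _)
  rw [← hc, hJeq, integral_const_mul, integral_sub hrhs (hsq.const_mul _), integral_const_mul]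
    at hJ
  have hJ' := nonneg_of_mul_nonneg_right hJ hZpos
  rw [hsqv] at hJ'
  rw [one_div, inv_mul_eq_div, le_div_iff₀ (by linarith)]
  nlinarith [mul_nonneg (by linarith : (0:ℝ) ≤ β - 1)
    (sq_nonneg (c - ∫ x, f x * (φ x ^ (-β) / Z)))]
end

section
/- Let β ≥ n+1 and τ_β be the Cauchy probability measure on ℝ^n with density Z_β^{-1}(1+|x|²)^{-β}. Then for any locally Lipschitz f ∈ L²(τ_β): Var_{τ_β}(f) ≤ (1/(2(β-1))) ∫ |∇f(x)|² (1+|x|²) dτ_β(x). -/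
open MeasureTheory

set_option linter.unusedSectionVars false

namespace WPC

open ProbabilityTheory Real Filter Topology

variable {E : Type*} [NormedAddCommGroup E] [InnerProductSpace ℝ E] [FiniteDimensional ℝ E]
  [MeasurableSpace E] [BorelSpace E]

/-- Standard Gaussian density. -/
noncomputable def gd (x : E) : ℝ :=
  (2 * π) ^ (-(Module.finrank ℝ E / 2 : ℝ)) * Real.exp (-(1 / 2) * ‖x‖ ^ 2)

lemma gd_nonneg (x : E) : 0 ≤ gd x := by unfold gd; positivity

lemma gd_pos (x : E) : 0 < gd x := by unfold gd; positivity

lemma gd_cont : Continuous (gd : E → ℝ) := by unfold gd; fun_prop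

lemma gd_integrable : Integrable (gd : E → ℝ) := by
  have h : (0:ℝ) < ((1 / 2 : ℝ) : ℂ).re := by norm_num
  have := (GaussianFourier.integrable_cexp_neg_mul_sq_norm_add h 0 (0 : E)).norm
  have h2 := this.const_mul ((2 * π) ^ (-(Module.finrank ℝ E / 2 : ℝ)))
  refine h2.congr (Eventually.of_forall fun x => ?_)
  simp only [gd, Complex.norm_exp]
  congr 2
  simp [← Complex.ofReal_pow]

lemma std_density : stdGaussian E = volume.withDensity (fun x => ENNReal.ofReal (gd x)) := by
  have hfin : IsFiniteMeasure ((volume : Measure E).withDensity (fun x => ENNReal.ofReal (gd x))) :=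
    isFiniteMeasure_withDensity_ofReal gd_integrable.2
  apply Measure.ext_of_charFun
  ext t
  rw [charFun_stdGaussian, charFun_apply, integral_withDensity_eq_integral_toReal_smul
    (by have := gd_cont (E := E); fun_prop) (by simp)]
  have h : (0:ℝ) < ((1 / 2 : ℝ) : ℂ).re := by norm_num
  have key := GaussianFourier.integral_cexp_neg_mul_sq_norm_add h Complex.I t
  have e : ∀ x : E, (ENNReal.ofReal (gd x)).toReal • Complex.exp (↑(inner ℝ x t) * Complex.I)
      = (((2 * π) ^ (-(Module.finrank ℝ E / 2 : ℝ)) : ℝ) : ℂ) *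
        Complex.exp (-((1 / 2 : ℝ) : ℂ) * ‖x‖ ^ 2 + Complex.I * inner ℝ t x) := by
    intro x
    rw [ENNReal.toReal_ofReal (gd_nonneg x), gd, Complex.real_smul, Complex.ofReal_mul, mul_assoc,
      Complex.ofReal_exp, ← Complex.exp_add, real_inner_comm]
    congr 2
    push_cast
    ring
  simp_rw [e]
  rw [integral_const_mul, key]
  have : ((π : ℂ) / ((1 / 2 : ℝ) : ℂ)) ^ (Module.finrank ℝ E / 2 : ℂ) =
      (((2 * π) ^ ((Module.finrank ℝ E / 2 : ℝ)) : ℝ) : ℂ) := by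
    rw [Complex.ofReal_cpow (by positivity)]
    push_cast
    congr 1
    ring
  rw [this, ← mul_assoc, ← Complex.ofReal_mul, ← Real.rpow_add (by positivity)]
  simp
  congr 1
  ring

lemma integral_std (h : E → ℝ) : ∫ x, h x ∂(stdGaussian E) = ∫ x, gd x * h x := by
  rw [std_density, integral_withDensity_eq_integral_toReal_smul
    (by have := gd_cont (E := E); fun_prop) (by simp)]
  simp [ENNReal.toReal_ofReal (gd_nonneg _)]

lemma std_ac : stdGaussian E ≪ (volume : Measure E) := by
  rw [std_density]; exact withDensity_absolutelyContinuous _ _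

lemma gd_hasFDerivAt (x : E) : HasFDerivAt (gd : E → ℝ) ((-gd x) • innerSL ℝ x) x := by
  have h := (((hasStrictFDerivAt_norm_sq x).hasFDerivAt.const_mul (-(1/2) : ℝ)).exp).const_mul
    ((2 * π) ^ (-(Module.finrank ℝ E / 2 : ℝ)))
  unfold gd
  refine h.congr_fderiv ?_
  ext v
  simp
  ring

lemma mul_exp_le (r : ℝ) : r * Real.exp (-(1/2) * r ^ 2) ≤ 1 := by
  have h1 := Real.add_one_le_exp (1/2 * r ^ 2)
  have h2 : r ≤ Real.exp (1/2 * r ^ 2) := by nlinarith [sq_nonneg (r - 1)]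
  have h3 : Real.exp (-(1/2) * r ^ 2) * Real.exp (1/2 * r ^ 2) = 1 := by
    rw [← Real.exp_add]; simp
  nlinarith [Real.exp_pos (-(1/2) * r ^ 2)]

lemma gd_lipschitz : ∃ C, LipschitzWith C (gd : E → ℝ) := by
  refine ⟨Real.toNNReal ((2 * π) ^ (-(Module.finrank ℝ E / 2 : ℝ))), ?_⟩
  apply lipschitzWith_of_nnnorm_fderiv_le (fun x => (gd_hasFDerivAt x).differentiableAt)
  intro x
  rw [(gd_hasFDerivAt x).fderiv, ← NNReal.coe_le_coe, coe_nnnorm, norm_smul, innerSL_apply_norm,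
    Real.coe_toNNReal _ (by positivity), norm_neg, Real.norm_of_nonneg (gd_nonneg x), gd, mul_assoc,
    mul_comm (Real.exp _)]
  exact mul_le_of_le_one_right (by positivity) (mul_exp_le _)

/-- Gaussian integration by parts. -/
lemma ibp {h : E → ℝ} {C : NNReal} (hh : LipschitzWith C h) (hc : HasCompactSupport h) (v : E) :
    ∫ x, h x * inner ℝ v x ∂(stdGaussian E) = ∫ x, lineDeriv ℝ h x v ∂(stdGaussian E) := by
  obtain ⟨D, hD⟩ := gd_lipschitz (E := E)
  have key := hD.integral_lineDeriv_mul_eq (μ := volume) hh hc v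
  rw [integral_std, integral_std]
  have e1 : ∀ x : E, lineDeriv ℝ gd x v * h x = -(gd x * (h x * inner ℝ v x)) := by
    intro x
    rw [((gd_hasFDerivAt x).hasLineDerivAt v).lineDeriv]
    simp [real_inner_comm]; ring
  have e2 : ∀ x : E, lineDeriv ℝ h x (-v) * gd x = - (gd x * lineDeriv ℝ h x v) := by
    intro x
    rw [lineDeriv_neg]; ring
  simp_rw [e1, e2, integral_neg] at key
  linarith

lemma grad_inner (f : E → ℝ) (x v : E) : inner ℝ (gradient f x) v = fderiv ℝ f x v := by
  simp [gradient]

lemma grad_norm (f : E → ℝ) (x : E) : ‖gradient f x‖ = ‖fderiv ℝ f x‖ := by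
  simp [gradient]

lemma grad_meas (f : E → ℝ) : Measurable (gradient f) := by
  unfold gradient
  exact (LinearIsometryEquiv.continuous _).measurable.comp (measurable_fderiv ℝ f)

lemma grad_bound {f : E → ℝ} {C : NNReal} (hf : LipschitzWith C f) (x : E) : ‖gradient f x‖ ≤ C := by
  rw [grad_norm]; exact norm_fderiv_le_of_lipschitz ℝ hf

lemma integral_norm_sq_std : ∫ x, ‖x‖ ^ 2 ∂(stdGaussian E) = Module.finrank ℝ E := by
  let b := stdOrthonormalBasis ℝ E
  have e : ∀ x : E, ‖x‖ ^ 2 = ∑ i, (inner ℝ (b i) x) ^ 2 := by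
    intro x
    rw [← b.sum_sq_norm_inner_right x]; simp
  simp_rw [e]
  have hm : ∀ i, MemLp (fun x : E => inner ℝ (b i) x) 2 (stdGaussian E) := fun i =>
    (IsGaussian.memLp_two_id (μ := stdGaussian E)).const_inner (b i)
  rw [integral_finsetSum _ (fun i _ => (hm i).integrable_sq)]
  have : ∀ i, ∫ x, (inner ℝ (b i) x) ^ 2 ∂(stdGaussian E) = 1 := by
    intro i
    have h1 := variance_dual_stdGaussian (E := E) (innerSL ℝ (b i))
    rw [variance_of_integral_eq_zero (by fun_prop) (integral_strongDual_stdGaussian _)] at h1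
    simpa using h1
  simp [this]

lemma rot_pres (θ : ℝ) : MeasurePreserving
    (fun p : E × E => (Real.cos θ • p.1 - Real.sin θ • p.2, Real.sin θ • p.1 + Real.cos θ • p.2))
    ((stdGaussian E).prod (stdGaussian E)) ((stdGaussian E).prod (stdGaussian E)) := by
  refine ⟨by fun_prop, ?_⟩
  have := IsGaussian.map_rotation_eq_self (μ := stdGaussian E) integral_id_stdGaussian (-θ)
  convert this using 2
  ext p <;> simp [ContinuousLinearMap.rotation_apply, sub_eq_add_neg]


section gauss

variable {f : E → ℝ} {C : NNReal}

local notation "γ" => stdGaussian E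
local notation "γ₂" => Measure.prod (stdGaussian E) (stdGaussian E)

lemma int_norm : Integrable (fun x : E => ‖x‖) γ :=
  (IsGaussian.integrable_id (μ := γ)).norm

lemma int_norm_sq : Integrable (fun x : E => ‖x‖ ^ 2) γ :=
  (IsGaussian.memLp_two_id (μ := γ)).norm.integrable_sq

lemma int_fst {F : Type*} [NormedAddCommGroup F] {h : E → F} (hh : Integrable h γ) :
    Integrable (fun p : E × E => h p.1) γ₂ :=
  hh.comp_fst γ

lemma int_snd {F : Type*} [NormedAddCommGroup F] {h : E → F} (hh : Integrable h γ) :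
    Integrable (fun p : E × E => h p.2) γ₂ :=
  hh.comp_snd γ

lemma integral_fst (h : E → ℝ) :
    ∫ p : E × E, h p.1 ∂γ₂ = ∫ x, h x ∂γ := by
  simpa using integral_fun_fst (μ := γ) (ν := γ) h

/-- the map `(x,y) ↦ cos θ x - sin θ y` pushes the product to `γ`. -/
lemma proj_pres (θ : ℝ) : MeasurePreserving
    (fun p : E × E => Real.cos θ • p.1 - Real.sin θ • p.2) γ₂ γ :=
  measurePreserving_fst.comp (rot_pres θ)

lemma cross_bound (hf : LipschitzWith C f) (θ k : ℝ) :
    ∫ p : E × E, inner ℝ (gradient f (Real.cos θ • p.1 - Real.sin θ • p.2)) (gradient f p.1)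
        ∂γ₂ ≤ ∫ x, ‖gradient f x‖ ^ 2 ∂γ
        - 2 * k * (1 - Real.cos θ) * (∫ x, inner ℝ (gradient f x) x ∂γ)
        + k ^ 2 * (1 - Real.cos θ) * Module.finrank ℝ E := by
  have hG := grad_meas f
  have hb := grad_bound hf
  set G := gradient f
  set c := Real.cos θ
  set s := Real.sin θ
  have hcs : c ^ 2 + s ^ 2 = 1 := Real.cos_sq_add_sin_sq θ
  set A := ∫ x, inner ℝ (G x) x ∂γ
  have iA : Integrable (fun x => inner ℝ (G x) x) γ := by
    refine (int_norm.const_mul (C:ℝ)).mono' (by fun_prop) (Eventually.of_forall fun x => ?_)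
    exact (norm_inner_le_norm _ _).trans (mul_le_mul_of_nonneg_right (hb x) (norm_nonneg _))
  have iGG : Integrable (fun x => ‖G x‖ ^ 2) γ := by
    refine (integrable_const ((C:ℝ)^2)).mono' (by fun_prop) (Eventually.of_forall fun x => ?_)
    simp only [norm_pow, norm_norm]
    gcongr; exact hb x
  -- mean zero
  have hz : ∀ u : E, ∫ y, inner ℝ u y ∂γ = 0 := fun u =>
    integral_strongDual_stdGaussian (innerSL ℝ u)
  have iGy : Integrable (fun p : E × E => inner ℝ (G p.1) p.2) γ₂ := by
    refine ((int_snd int_norm).const_mul (C:ℝ)).mono' (by fun_prop)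
      (Eventually.of_forall fun p => ?_)
    exact (norm_inner_le_norm _ _).trans (mul_le_mul_of_nonneg_right (hb _) (norm_nonneg _))
  have eGy : ∫ p : E × E, inner ℝ (G p.1) p.2 ∂γ₂ = 0 := by
    rw [integral_prod _ iGy]; simp [hz]
  have ixy : Integrable (fun p : E × E => inner ℝ p.1 p.2) γ₂ := by
    refine ((int_fst int_norm_sq).add (int_snd int_norm_sq)).mono' (by fun_prop)
      (Eventually.of_forall fun p => ?_)
    refine (norm_inner_le_norm _ _).trans ?_
    simp only [Pi.add_apply]
    nlinarith [sq_nonneg (‖p.1‖ - ‖p.2‖), sq_nonneg (‖p.1‖), sq_nonneg (‖p.2‖)]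
  have exy : ∫ p : E × E, inner ℝ p.1 p.2 ∂γ₂ = 0 := by
    rw [integral_prod _ ixy]; simp [hz]
  -- the six expectations
  let P : E × E → E := fun p => c • p.1 - s • p.2
  have hP : MeasurePreserving P γ₂ γ := proj_pres θ
  have hPm : Measurable P := hP.measurable
  have transfer : ∀ h : E → ℝ, AEStronglyMeasurable h γ →
      ∫ p, h (P p) ∂γ₂ = ∫ x, h x ∂γ := by
    intro h hh
    have := integral_map (μ := γ₂) hPm.aemeasurable (f := h) (by rwa [hP.map_eq])
    rw [hP.map_eq] at this
    exact this.symm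
  have i1 : Integrable (fun p => ‖G (P p)‖ ^ 2) γ₂ := hP.integrable_comp_of_integrable iGG
  have e1 : ∫ p, ‖G (P p)‖ ^ 2 ∂γ₂ = ∫ x, ‖G x‖ ^ 2 ∂γ := transfer _ iGG.1
  have i2 := int_fst iGG
  have e2 := integral_fst (E := E) (fun x => ‖G x‖ ^ 2)
  have i3 : Integrable (fun p : E × E => inner ℝ (G (P p)) (G p.1)) γ₂ := by
    refine (integrable_const ((C:ℝ) * C)).mono' (by fun_prop) (Eventually.of_forall fun p => ?_)
    exact (norm_inner_le_norm _ _).trans (mul_le_mul (hb _) (hb _) (norm_nonneg _) C.2)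
  have i4 : Integrable (fun p => inner ℝ (G (P p)) (P p)) γ₂ :=
    hP.integrable_comp_of_integrable iA
  have e4 : ∫ p, inner ℝ (G (P p)) (P p) ∂γ₂ = A := transfer _ iA.1
  have i5 := int_fst iA
  have e5 := integral_fst (E := E) (fun x => inner ℝ (G x) x)
  have i6 : Integrable (fun p : E × E => inner ℝ (G p.1) (P p)) γ₂ := by
    have : (fun p : E × E => inner ℝ (G p.1) (P p)) =
      fun p => c * inner ℝ (G p.1) p.1 - s * inner ℝ (G p.1) p.2 := by
      ext p; simp [P, inner_sub_right, inner_smul_right]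
    rw [this]
    exact (i5.const_mul c).sub (iGy.const_mul s)
  have e6 : ∫ p : E × E, inner ℝ (G p.1) (P p) ∂γ₂ = c * A := by
    have : (fun p : E × E => inner ℝ (G p.1) (P p)) =
      fun p => c * inner ℝ (G p.1) p.1 - s * inner ℝ (G p.1) p.2 := by
      ext p; simp [P, inner_sub_right, inner_smul_right]
    rw [this, integral_sub (i5.const_mul c) (iGy.const_mul s), integral_const_mul,
      integral_const_mul, eGy, e5]
    ring
  have h7 : (fun p : E × E => inner ℝ (G (P p)) p.1) = (fun q : E × E =>
      inner ℝ (G q.1) (c • q.1 + s • q.2)) ∘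
      (fun p : E × E => (c • p.1 - s • p.2, s • p.1 + c • p.2)) := by
    ext p
    simp only [Function.comp, P]
    congr 1
    calc p.1 = (c ^ 2 + s ^ 2) • p.1 := by rw [hcs, one_smul]
      _ = _ := by module
  have j7 : Integrable (fun q : E × E => inner ℝ (G q.1) (c • q.1 + s • q.2)) γ₂ := by
    have : (fun q : E × E => inner ℝ (G q.1) (c • q.1 + s • q.2)) =
      fun p => c * inner ℝ (G p.1) p.1 + s * inner ℝ (G p.1) p.2 := by
      ext p; simp [inner_add_right, inner_smul_right]
    rw [this]
    exact (i5.const_mul c).add (iGy.const_mul s)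
  have i7 : Integrable (fun p : E × E => inner ℝ (G (P p)) p.1) γ₂ := by
    rw [h7]; exact (rot_pres θ).integrable_comp_of_integrable j7
  have e7 : ∫ p : E × E, inner ℝ (G (P p)) p.1 ∂γ₂ = c * A := by
    rw [h7]
    have hm := (rot_pres (E := E) θ)
    have := integral_map (μ := γ₂) hm.measurable.aemeasurable
      (f := fun q : E × E => inner ℝ (G q.1) (c • q.1 + s • q.2)) (by rw [hm.map_eq]; exact j7.1)
    rw [hm.map_eq] at this
    refine this.symm.trans ?_
    have : (fun q : E × E => inner ℝ (G q.1) (c • q.1 + s • q.2)) =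
      fun p => c * inner ℝ (G p.1) p.1 + s * inner ℝ (G p.1) p.2 := by
      ext p; simp [inner_add_right, inner_smul_right]
    rw [this, integral_add (i5.const_mul c) (iGy.const_mul s), integral_const_mul,
      integral_const_mul, eGy, e5]
    ring
  have i8 : Integrable (fun p : E × E => ‖P p‖ ^ 2) γ₂ :=
    hP.integrable_comp_of_integrable int_norm_sq
  have e8 : ∫ p : E × E, ‖P p‖ ^ 2 ∂γ₂ = Module.finrank ℝ E :=
    (transfer _ int_norm_sq.1).trans integral_norm_sq_std
  have i9 := int_fst (E := E) int_norm_sq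
  have e9 := (integral_fst (E := E) (fun x => ‖x‖ ^ 2)).trans integral_norm_sq_std
  have hPx : (fun p : E × E => inner ℝ (P p) p.1) =
      fun p => c * ‖p.1‖ ^ 2 - s * inner ℝ p.1 p.2 := by
    ext p
    simp [P, inner_sub_left, inner_smul_left, real_inner_comm]
  have i10 : Integrable (fun p : E × E => inner ℝ (P p) p.1) γ₂ := by
    rw [hPx]; exact (i9.const_mul c).sub (ixy.const_mul s)
  have e10 : ∫ p : E × E, inner ℝ (P p) p.1 ∂γ₂ = c * Module.finrank ℝ E := by
    rw [hPx, integral_sub (i9.const_mul c) (ixy.const_mul s), integral_const_mul,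
      integral_const_mul, exy, e9]
    ring
  have key : 0 ≤ ∫ p : E × E, ‖(G (P p) - G p.1) - k • (P p - p.1)‖ ^ 2 ∂γ₂ :=
    integral_nonneg fun p => by positivity
  have expand : (fun p : E × E => ‖(G (P p) - G p.1) - k • (P p - p.1)‖ ^ 2) = fun p =>
      (((‖G (P p)‖ ^ 2 + ‖G p.1‖ ^ 2) - 2 * inner ℝ (G (P p)) (G p.1))
      - 2 * k * ((inner ℝ (G (P p)) (P p) + inner ℝ (G p.1) p.1) -
          (inner ℝ (G p.1) (P p) + inner ℝ (G (P p)) p.1)))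
      + k ^ 2 * ((‖P p‖ ^ 2 + ‖p.1‖ ^ 2) - 2 * inner ℝ (P p) p.1) := by
    ext p
    generalize P p = q
    rw [norm_sub_sq_real, norm_smul, mul_pow, norm_sub_sq_real, norm_sub_sq_real, inner_smul_right,
      inner_sub_left, inner_sub_right (G q), inner_sub_right (G p.1)]
    simp only [Real.norm_eq_abs, sq_abs]
    ring
  rw [expand, integral_add, integral_sub, integral_sub, integral_add i1 i2, integral_const_mul,
    integral_const_mul, integral_sub (i4.fun_add i5) (i6.fun_add i7), integral_add i4 i5,
    integral_add i6 i7, integral_const_mul, integral_sub (i8.fun_add i9) (i10.const_mul 2),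
    integral_add i8 i9, integral_const_mul, e1, e2, e4, e5, e6, e7, e8, e9, e10] at key
  · change ∫ p : E × E, inner ℝ (G (P p)) (G p.1) ∂γ₂ ≤ _
    linarith
  · exact i1.add i2
  · exact i3.const_mul 2
  · exact (i1.add i2).sub (i3.const_mul 2)
  · exact ((i4.add i5).sub (i6.add i7)).const_mul _
  · exact ((i1.add i2).sub (i3.const_mul 2)).sub (((i4.add i5).sub (i6.add i7)).const_mul _)
  · exact ((i8.add i9).sub (i10.const_mul 2)).const_mul _

end gauss

section gauss2

variable {f : E → ℝ} {C : NNReal}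

local notation "γ" => stdGaussian E
local notation "γ₂" => Measure.prod (stdGaussian E) (stdGaussian E)

lemma bounded_of_cs (hf : LipschitzWith C f) (hc : HasCompactSupport f) :
    ∃ M : ℝ, 0 ≤ M ∧ ∀ x, |f x| ≤ M := by
  obtain ⟨M, hM⟩ := hf.continuous.bounded_above_of_compact_support hc
  exact ⟨M, (norm_nonneg _).trans (hM 0), hM⟩

lemma ae_diff_std (hf : LipschitzWith C f) : ∀ᵐ x ∂γ, DifferentiableAt ℝ f x :=
  std_ac.ae_le hf.ae_differentiableAt

/-- derivative of the interpolation -/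
lemma interp_deriv (hf : LipschitzWith C f) (hc : HasCompactSupport f) (θ : ℝ) :
    HasDerivAt (fun θ : ℝ => ∫ p : E × E, f p.1 * f (Real.cos θ • p.1 + Real.sin θ • p.2) ∂γ₂)
      (∫ p : E × E, f p.1 * inner ℝ (gradient f (Real.cos θ • p.1 + Real.sin θ • p.2))
        (-Real.sin θ • p.1 + Real.cos θ • p.2) ∂γ₂) θ := by
  obtain ⟨M, hM0, hM⟩ := bounded_of_cs hf hc
  have hfc := hf.continuous
  have hG := grad_meas f
  refine (hasDerivAt_integral_of_dominated_loc_of_lip (μ := γ₂) (s := Set.univ)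
    (bound := fun p : E × E => M * (C * (‖p.1‖ + ‖p.2‖))) univ_mem
    (Eventually.of_forall fun t => ?_) ?_ ?_ ?_ ?_ ?_).2
  · exact (by fun_prop : Continuous fun p : E × E =>
      f p.1 * f (Real.cos t • p.1 + Real.sin t • p.2)).aestronglyMeasurable
  · refine (integrable_const (M * M)).mono' ((by fun_prop : Continuous fun p : E × E =>
      f p.1 * f (Real.cos θ • p.1 + Real.sin θ • p.2)).aestronglyMeasurable)
      (Eventually.of_forall fun p => ?_)
    rw [norm_mul]
    exact mul_le_mul (hM _) (hM _) (norm_nonneg _) hM0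
  · have h1 : Measurable (fun p : E × E => f p.1) := by fun_prop
    fun_prop
  · refine Eventually.of_forall fun p => LipschitzOnWith.of_dist_le_mul fun a _ b _ => ?_
    have hnn : 0 ≤ M * (C * (‖p.1‖ + ‖p.2‖)) := by positivity
    rw [Real.coe_nnabs, abs_of_nonneg hnn, Real.dist_eq, ← mul_sub, abs_mul]
    have h1 := hf.dist_le_mul (Real.cos a • p.1 + Real.sin a • p.2)
      (Real.cos b • p.1 + Real.sin b • p.2)
    rw [Real.dist_eq] at h1
    have h2 : dist (Real.cos a • p.1 + Real.sin a • p.2) (Real.cos b • p.1 + Real.sin b • p.2)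
        ≤ (‖p.1‖ + ‖p.2‖) * dist a b := by
      rw [dist_eq_norm]
      have : Real.cos a • p.1 + Real.sin a • p.2 - (Real.cos b • p.1 + Real.sin b • p.2)
        = (Real.cos a - Real.cos b) • p.1 + (Real.sin a - Real.sin b) • p.2 := by module
      rw [this]
      refine (norm_add_le _ _).trans ?_
      rw [norm_smul, norm_smul]
      have hc1 : ‖Real.cos a - Real.cos b‖ ≤ dist a b := by
        have := Real.abs_cos_sub_cos_le a b
        simpa [Real.dist_eq] using this
      have hs1 : ‖Real.sin a - Real.sin b‖ ≤ dist a b := by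
        have := Real.abs_sin_sub_sin_le a b
        simpa [Real.dist_eq] using this
      nlinarith [norm_nonneg p.1, norm_nonneg p.2]
    calc |f p.1| * _ ≤ M * (C * ((‖p.1‖ + ‖p.2‖) * dist a b)) := by
          refine mul_le_mul (hM _) (h1.trans ?_) (abs_nonneg _) hM0
          gcongr
      _ = _ := by ring
  · exact (((int_fst int_norm).add (int_snd int_norm)).const_mul (C:ℝ)).const_mul M
  · have hd := (proj_pres (E := E) (-θ)).quasiMeasurePreserving.ae (ae_diff_std hf)
    filter_upwards [hd] with p hp
    simp only [Real.cos_neg, Real.sin_neg, neg_smul, sub_neg_eq_add] at hp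
    have h1 : HasDerivAt (fun t : ℝ => Real.cos t • p.1 + Real.sin t • p.2)
        (-Real.sin θ • p.1 + Real.cos θ • p.2) θ :=
      ((Real.hasDerivAt_cos θ).smul_const p.1).add ((Real.hasDerivAt_sin θ).smul_const p.2)
    have h2 := (hp.hasFDerivAt.comp_hasDerivAt θ h1).const_mul (f p.1)
    rw [grad_inner]
    exact h2

lemma interp_deriv_eq (hf : LipschitzWith C f) (hc : HasCompactSupport f) (θ : ℝ)
    (hs : Real.sin θ ≠ 0) :
    ∫ p : E × E, f p.1 * inner ℝ (gradient f (Real.cos θ • p.1 + Real.sin θ • p.2))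
        (-Real.sin θ • p.1 + Real.cos θ • p.2) ∂γ₂ =
    - Real.sin θ * ∫ p : E × E,
      inner ℝ (gradient f (Real.cos θ • p.1 - Real.sin θ • p.2)) (gradient f p.1) ∂γ₂ := by
  obtain ⟨M, hM0, hM⟩ := bounded_of_cs hf hc
  have hfc := hf.continuous
  have hfm := hfc.measurable
  have hG := grad_meas f
  have hb := grad_bound hf
  have hm := rot_pres (E := E) θ
  have hd := (proj_pres (E := E) θ).quasiMeasurePreserving.ae (ae_diff_std hf)
  set c := Real.cos θ
  set s := Real.sin θ
  have hcs : c ^ 2 + s ^ 2 = 1 := Real.cos_sq_add_sin_sq θ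
  have step1 : ∫ p : E × E, f p.1 * inner ℝ (gradient f (c • p.1 + s • p.2))
        (-s • p.1 + c • p.2) ∂γ₂ =
      ∫ q : E × E, f (c • q.1 - s • q.2) * inner ℝ (gradient f q.1) q.2 ∂γ₂ := by
    have := integral_map (μ := γ₂) hm.measurable.aemeasurable
      (f := fun p : E × E => f p.1 * inner ℝ (gradient f (c • p.1 + s • p.2))
        (-s • p.1 + c • p.2)) (by fun_prop)
    rw [hm.map_eq] at this
    rw [this]
    congr 1
    ext q
    have h1 : c • (c • q.1 - s • q.2) + s • (s • q.1 + c • q.2) = q.1 := by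
      calc _ = (c ^ 2 + s ^ 2) • q.1 := by module
        _ = _ := by rw [hcs, one_smul]
    have h2 : -s • (c • q.1 - s • q.2) + c • (s • q.1 + c • q.2) = q.2 := by
      calc _ = (c ^ 2 + s ^ 2) • q.2 := by module
        _ = _ := by rw [hcs, one_smul]
    simp only [h1, h2]
  have i1 : Integrable (fun q : E × E => f (c • q.1 - s • q.2) * inner ℝ (gradient f q.1) q.2)
      γ₂ := by
    refine ((int_snd int_norm).const_mul (M * C)).mono' (by fun_prop)
      (Eventually.of_forall fun p => ?_)
    rw [norm_mul, mul_assoc]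
    refine mul_le_mul (hM _) ?_ (norm_nonneg _) hM0
    exact (norm_inner_le_norm _ _).trans (mul_le_mul_of_nonneg_right (hb _) (norm_nonneg _))
  have i2 : Integrable (fun p : E × E => inner ℝ (gradient f (c • p.1 - s • p.2))
      (gradient f p.1)) γ₂ := by
    refine (integrable_const ((C:ℝ) * C)).mono' (by fun_prop) (Eventually.of_forall fun p => ?_)
    exact (norm_inner_le_norm _ _).trans (mul_le_mul (hb _) (hb _) (norm_nonneg _) C.2)
  rw [step1, integral_prod _ i1, integral_prod _ i2, ← integral_const_mul]
  apply integral_congr_ae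
  filter_upwards [Measure.ae_ae_of_ae_prod hd] with x hx
  have hA : LipschitzWith (‖s‖₊) (fun y : E => c • x - s • y) := by
    refine LipschitzWith.of_dist_le_mul fun a b => ?_
    rw [dist_eq_norm, dist_eq_norm, coe_nnnorm, ← norm_smul,
      show c • x - s • a - (c • x - s • b) = -(s • (a - b)) by module, norm_neg]
  have hcl : HasCompactSupport (fun y : E => f (c • x - s • y)) := by
    have h : (fun y : E => f (c • x - s • y)) = f ∘ ((Homeomorph.smulOfNeZero (-s) (neg_ne_zero.2 hs)).trans
        (Homeomorph.addLeft (c • x))) := by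
      ext y; simp [sub_eq_add_neg]
    rw [h]
    exact hc.comp_homeomorph _
  refine (ibp (hf.comp hA) hcl (gradient f x)).trans ?_
  rw [← integral_const_mul]
  apply integral_congr_ae
  filter_upwards [hx] with y hy
  have h1 : HasFDerivAt (fun y : E => c • x - s • y) (-(s • ContinuousLinearMap.id ℝ E)) y :=
    ((hasFDerivAt_id y).const_smul s).const_sub (c • x)
  have h2 := (hy.hasFDerivAt.comp y h1).hasLineDerivAt (gradient f x)
  rw [grad_inner]
  rw [show (f ∘ fun y => c • x - s • y) = (f ∘ (fun y : E => c • x - s • y)) from rfl, h2.lineDeriv]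
  simp

/-- Improved Gaussian Poincaré inequality. -/
lemma gauss_poincare (hf : LipschitzWith C f) (hc : HasCompactSupport f) (k : ℝ) :
    ∫ x, f x ^ 2 ∂γ - (∫ x, f x ∂γ) ^ 2 ≤ ∫ x, ‖gradient f x‖ ^ 2 ∂γ
      - (2 * k * (∫ x, inner ℝ (gradient f x) x ∂γ) - k ^ 2 * Module.finrank ℝ E) / 2 := by
  set D := ∫ x, ‖gradient f x‖ ^ 2 ∂γ with hD
  set A := ∫ x, inner ℝ (gradient f x) x ∂γ with hA
  set B := 2 * k * A - k ^ 2 * Module.finrank ℝ E with hB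
  let φ : ℝ → ℝ := fun θ => ∫ p : E × E, f p.1 * f (Real.cos θ • p.1 + Real.sin θ • p.2) ∂γ₂
  have hφ := interp_deriv hf hc
  let ψ : ℝ → ℝ := fun θ => φ θ - (D * Real.cos θ - B * (Real.cos θ - Real.cos θ ^ 2 / 2))
  have hψ : ∀ θ, HasDerivAt ψ ((∫ p : E × E, f p.1 * inner ℝ (gradient f
      (Real.cos θ • p.1 + Real.sin θ • p.2)) (-Real.sin θ • p.1 + Real.cos θ • p.2) ∂γ₂) -
      (D * (-Real.sin θ) - B * (-Real.sin θ - (2 * Real.cos θ * (-Real.sin θ)) / 2))) θ := by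
    intro θ
    have h1 := Real.hasDerivAt_cos θ
    have h2 := (h1.const_mul D).fun_sub ((h1.fun_sub ((h1.fun_pow 2).div_const 2)).const_mul B)
    have h3 := (hφ θ).fun_sub h2
    refine h3.congr_deriv ?_
    simp
  have hmono : MonotoneOn ψ (Set.Icc 0 (π / 2)) := by
    apply monotoneOn_of_deriv_nonneg (convex_Icc _ _)
    · exact fun θ _ => (hψ θ).continuousAt.continuousWithinAt
    · exact fun θ _ => (hψ θ).differentiableAt.differentiableWithinAt
    · intro θ hθ
      rw [interior_Icc] at hθ
      have hs : 0 < Real.sin θ := Real.sin_pos_of_pos_of_lt_pi hθ.1 (by linarith [hθ.2, Real.pi_pos])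
      rw [(hψ θ).deriv, interp_deriv_eq hf hc θ hs.ne']
      have := mul_le_mul_of_nonneg_left (cross_bound hf θ k) hs.le
      rw [hB]
      linarith
  have h := hmono (Set.left_mem_Icc.2 (by positivity)) (Set.right_mem_Icc.2 (by positivity))
    (by positivity : (0:ℝ) ≤ π / 2)
  have e0 : φ 0 = ∫ x, f x ^ 2 ∂γ := by
    simp only [φ, Real.cos_zero, Real.sin_zero, one_smul, zero_smul, add_zero]
    rw [integral_fst (fun x => f x * f x)]
    simp_rw [sq]
  have e1 : φ (π / 2) = (∫ x, f x ∂γ) ^ 2 := by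
    simp only [φ, Real.cos_pi_div_two, Real.sin_pi_div_two, one_smul, zero_smul, zero_add]
    rw [integral_prod_mul (μ := γ) (ν := γ) f f, sq]
  simp only [ψ, e0, e1, Real.cos_zero, Real.cos_pi_div_two] at h
  linarith

end gauss2

section gam

/-- unnormalized Gamma weight -/
noncomputable def gw (a t : ℝ) : ℝ := Real.exp (-t) * t ^ (a - 1)

lemma gw_nonneg {a t : ℝ} (ht : 0 < t) : 0 ≤ gw a t := by unfold gw; positivity

lemma gw_deriv (a : ℝ) {t : ℝ} (ht : 0 < t) :
    HasDerivAt (gw a) (gw a t * ((a - 1) / t - 1)) t := by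
  have h1 : HasDerivAt (fun t : ℝ => Real.exp (-t)) (Real.exp (-t) * (-1)) t :=
    (hasDerivAt_neg t).exp
  have h2 := Real.hasDerivAt_rpow_const (x := t) (p := a - 1) (Or.inl ht.ne')
  refine (h1.mul h2).congr_deriv ?_
  rw [gw, Real.rpow_sub_one ht.ne' (a - 1)]
  generalize t ^ (a - 1) = u
  field_simp
  ring

lemma gw_int {a : ℝ} (ha : 0 < a) : IntegrableOn (gw a) (Set.Ioi 0) :=
  Real.GammaIntegral_convergent ha

variable {a : ℝ} {F F' : ℝ → ℝ} {M K : ℝ}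

lemma int_bdd_gw {h : ℝ → ℝ} (ha : 0 < a)
    (hm : AEStronglyMeasurable h (volume.restrict (Set.Ioi 0)))
    (hb : ∀ t, 0 < t → |h t| ≤ M) : IntegrableOn (fun t => h t * gw a t) (Set.Ioi 0) := by
  refine Integrable.bdd_mul (c := M) (gw_int ha) hm ?_
  filter_upwards [ae_restrict_mem measurableSet_Ioi] with t ht
  exact hb t ht

lemma gamma_poincare (ha : 1 < a) (hF : ∀ t, 0 < t → HasDerivAt F (F' t) t)
    (hM : ∀ t, 0 < t → |F t| ≤ M) (hK : ∀ t, 0 < t → |t * F' t| ≤ K) :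
    ∃ c, |c| ≤ M ∧ (a - 1) * ∫ t in Set.Ioi 0, (F t - c) ^ 2 * gw a t ≤
      ∫ t in Set.Ioi 0, (t * F' t) ^ 2 * gw a t := by
  obtain ⟨l, hl⟩ : ∃ l, l = a - 1 := ⟨_, rfl⟩
  have hl0 : 0 < l := by rw [hl]; linarith
  refine ⟨F l, hM l hl0, ?_⟩
  rw [← hl]
  have ha0 : 0 < a := by linarith
  have hFc : ContinuousOn F (Set.Ioi 0) := fun t ht => (hF t ht).continuousAt.continuousWithinAt
  have hFm : AEStronglyMeasurable F (volume.restrict (Set.Ioi 0)) :=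
    hFc.aestronglyMeasurable measurableSet_Ioi
  have hF'm : AEStronglyMeasurable F' (volume.restrict (Set.Ioi 0)) := by
    refine (measurable_deriv F).aestronglyMeasurable.congr ?_
    filter_upwards [ae_restrict_mem measurableSet_Ioi] with t ht
    exact (hF t ht).deriv
  have I1 : IntegrableOn (fun t => (F t - F l) ^ 2 * gw a t) (Set.Ioi 0) := by
    refine int_bdd_gw (M := (M + M) ^ 2) ha0 (by fun_prop) fun t ht => ?_
    rw [abs_pow]
    gcongr
    exact (abs_sub _ _).trans (add_le_add (hM t ht) (hM l hl0))
  have I2 : IntegrableOn (fun t => (t * F' t) ^ 2 * gw a t) (Set.Ioi 0) := by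
    refine int_bdd_gw (M := K ^ 2) ha0 (by fun_prop) fun t ht => ?_
    rw [abs_pow]
    gcongr
    exact hK t ht
  let h : ℝ → ℝ := fun t => (t * F' t) ^ 2 * gw a t - l * ((F t - F l) ^ 2 * gw a t)
  have Ih : IntegrableOn h (Set.Ioi 0) := I2.sub (I1.const_mul l)
  suffices H : 0 ≤ ∫ t in Set.Ioi 0, h t by
    have : ∫ t in Set.Ioi 0, h t = (∫ t in Set.Ioi 0, (t * F' t) ^ 2 * gw a t) -
        l * ∫ t in Set.Ioi 0, (F t - F l) ^ 2 * gw a t := by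
      rw [← integral_const_mul]
      exact integral_sub I2 (I1.const_mul l)
    linarith
  let Φ : ℝ → ℝ := fun t => (F t - F l) * dslope F l t * (gw a t * (l * t))
  have hΦl : Φ l = 0 := by simp [Φ]
  have hΦc : ∀ t, 0 < t → ContinuousAt Φ t := by
    intro t ht
    have h1 : ContinuousAt (dslope F l) t := by
      by_cases htl : t = l
      · subst htl; exact continuousAt_dslope_same.2 (hF t ht).differentiableAt
      · exact (continuousAt_dslope_of_ne htl).2 (hF t ht).continuousAt
    have h2 := (hF t ht).continuousAt
    have h3 := (gw_deriv a ht).continuousAt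
    exact ((h2.sub continuousAt_const).mul h1).mul (h3.mul (by fun_prop))
  let Φ' : ℝ → ℝ := fun t => 2 * (F t - F l) * F' t * gw a t * (l * t) / (t - l)
    - (F t - F l) ^ 2 * gw a t * l ^ 2 / (t - l) ^ 2 - l * ((F t - F l) ^ 2 * gw a t)
  have hΦd : ∀ t, 0 < t → t ≠ l → HasDerivAt Φ (Φ' t) t := by
    intro t ht htl
    have htl' : t - l ≠ 0 := sub_ne_zero.2 htl
    have h2 := (hF t ht).sub_const (F l)
    have h4 : HasDerivAt (fun t => t - l) 1 t := (hasDerivAt_id t).sub_const l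
    have h5 : HasDerivAt (fun t => l * t) l t := by
      simpa using (hasDerivAt_id t).const_mul l
    have h6 := (h2.fun_mul (h2.fun_div h4 htl')).fun_mul ((gw_deriv a ht).fun_mul h5)
    have h7 : Φ =ᶠ[𝓝 t] fun t => (F t - F l) * ((F t - F l) / (t - l)) * (gw a t * (l * t)) := by
      filter_upwards [isOpen_ne.mem_nhds htl] with u hu
      simp only [Φ]
      rw [dslope_of_ne _ hu, slope_def_field]
    refine (h6.congr_of_eventuallyEq h7).congr_deriv ?_
    simp only [Φ']
    rw [← hl]
    field_simp
    ring
  have hle : ∀ t, 0 < t → t ≠ l → Φ' t ≤ h t := by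
    intro t ht htl
    have htl' : t - l ≠ 0 := sub_ne_zero.2 htl
    have h1 : h t - Φ' t = gw a t * (t * F' t - (F t - F l) * l / (t - l)) ^ 2 := by
      simp only [h, Φ']
      field_simp
      ring
    have h2 : 0 ≤ gw a t * (t * F' t - (F t - F l) * l / (t - l)) ^ 2 :=
      mul_nonneg (gw_nonneg ht) (sq_nonneg _)
    linarith
  -- boundary sign
  have hsgn : ∀ t, 0 < t → t ≠ l → 0 ≤ Φ t * (t - l) := by
    intro t ht htl
    have htl' : t - l ≠ 0 := sub_ne_zero.2 htl
    have : Φ t * (t - l) = (F t - F l) ^ 2 * (gw a t * (l * t)) := by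
      simp only [Φ]
      rw [dslope_of_ne _ htl, slope_def_field]
      field_simp
    rw [this]
    have := gw_nonneg (a := a) ht
    positivity
  have right : ∀ T, l < T → 0 ≤ ∫ t in l..T, h t := by
    intro T hT
    have h1 := intervalIntegral.sub_le_integral_of_hasDeriv_right_of_le (g := Φ) (g' := Φ')
      (φ := h) hT.le
      (fun t ht => (hΦc t (hl0.trans_le ht.1)).continuousWithinAt)
      (fun t ht => (hΦd t (hl0.trans ht.1) ht.1.ne').hasDerivWithinAt)
      (Ih.mono_set fun t ht => hl0.trans_le ht.1)
      (fun t ht => hle t (hl0.trans ht.1) ht.1.ne')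
    have h2 := hsgn T (hl0.trans hT) hT.ne'
    have h3 : 0 ≤ Φ T := nonneg_of_mul_nonneg_left h2 (by linarith)
    linarith
  have left : ∀ e, 0 < e → e < l → 0 ≤ ∫ t in e..l, h t := by
    intro e he hel
    have h1 := intervalIntegral.sub_le_integral_of_hasDeriv_right_of_le (g := Φ) (g' := Φ')
      (φ := h) hel.le
      (fun t ht => (hΦc t (he.trans_le ht.1)).continuousWithinAt)
      (fun t ht => (hΦd t (he.trans ht.1) ht.2.ne).hasDerivWithinAt)
      (Ih.mono_set fun t ht => he.trans_le ht.1)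
      (fun t ht => hle t (he.trans ht.1) ht.2.ne)
    have h2 := hsgn e he hel.ne
    have h3 : Φ e ≤ 0 := by
      by_contra hcon
      push Not at hcon
      nlinarith
    linarith
  have R : 0 ≤ ∫ t in Set.Ioi l, h t := by
    have := intervalIntegral_tendsto_integral_Ioi l
      (Ih.mono_set (Set.Ioi_subset_Ioi hl0.le)) tendsto_id
    refine ge_of_tendsto this ?_
    filter_upwards [eventually_gt_atTop l] with T hT using right T hT
  have Iioc : IntegrableOn h (Set.Ioc 0 l) := Ih.mono_set Set.Ioc_subset_Ioi_self
  have Lf : 0 ≤ ∫ t in Set.Ioc 0 l, h t := by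
    rw [← intervalIntegral.integral_of_le hl0.le]
    have hc := intervalIntegral.continuousOn_primitive_interval_left (f := h) (a := 0) (b := l)
      (μ := volume) (by rw [Set.uIcc_of_le hl0.le]; exact ((integrableOn_Icc_iff_integrableOn_Ioc (by simp)).2 Iioc))
    have h0 := (hc 0 (by simp)).mono_left
      (nhdsWithin_mono 0 (show Set.Ioc 0 l ⊆ Set.uIcc 0 l by
        rw [Set.uIcc_of_le hl0.le]; exact Set.Ioc_subset_Icc_self))
    have : (𝓝[Set.Ioc 0 l] (0:ℝ)).NeBot := by
      rw [nhdsWithin_Ioc_eq_nhdsGT hl0]; infer_instance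
    refine ge_of_tendsto h0 ?_
    filter_upwards [self_mem_nhdsWithin] with e he
    rcases he.2.lt_or_eq with h1 | h1
    · exact left e he.1 h1
    · rw [h1]; simp
  have hun : Set.Ioi (0:ℝ) = Set.Ioc 0 l ∪ Set.Ioi l := (Set.Ioc_union_Ioi_eq_Ioi hl0.le).symm
  rw [hun, setIntegral_union (Set.Ioc_disjoint_Ioi le_rfl) measurableSet_Ioi Iioc
    (Ih.mono_set (Set.Ioi_subset_Ioi hl0.le))]
  linarith

end gam

section mix

local notation "γ" => stdGaussian E
local notation "dimE" => (Module.finrank ℝ E : ℝ)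

/-- Expectation under the centered Gaussian of variance `1/(2t)`. -/
noncomputable def Et (h : E → ℝ) (t : ℝ) : ℝ := ∫ x, h ((√(2 * t))⁻¹ • x) ∂γ

lemma Et_eq (h : E → ℝ) {t : ℝ} (ht : 0 < t) :
    Et h t = π ^ (-(dimE / 2)) * (t ^ (dimE / 2) * ∫ y, Real.exp (-t * ‖y‖ ^ 2) * h y) := by
  have hs : 0 < √(2 * t) := by positivity
  rw [Et, integral_std]
  have h1 : ∀ x : E, gd x * h ((√(2 * t))⁻¹ • x) =
      (fun y : E => gd (√(2 * t) • y) * h y) ((√(2 * t))⁻¹ • x) := by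
    intro x
    simp only [smul_smul, mul_inv_cancel₀ hs.ne', one_smul]
  rw [integral_congr_ae (Eventually.of_forall h1),
    Measure.integral_comp_inv_smul volume (fun y : E => gd (√(2 * t) • y) * h y) (√(2 * t))]
  have h2 : ∀ y : E, gd (√(2 * t) • y) * h y =
      (2 * π) ^ (-(dimE / 2)) * (Real.exp (-t * ‖y‖ ^ 2) * h y) := by
    intro y
    rw [gd, norm_smul, mul_pow, Real.norm_of_nonneg hs.le, Real.sq_sqrt (by positivity)]
    rw [show -(1 / 2) * (2 * t * ‖y‖ ^ 2) = -t * ‖y‖ ^ 2 by ring]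
    ring
  simp_rw [h2]
  rw [integral_const_mul, smul_eq_mul, abs_of_nonneg (by positivity), ← mul_assoc, ← mul_assoc]
  congr 1
  rw [← Real.rpow_natCast, Real.sqrt_eq_rpow, ← Real.rpow_mul (by positivity),
    show (1 / 2 * dimE) = dimE / 2 by ring, Real.mul_rpow (by norm_num) ht.le,
    Real.mul_rpow (by norm_num) Real.pi_pos.le]
  have : (2:ℝ) ^ (dimE / 2) * 2 ^ (-(dimE / 2)) = 1 := by
    rw [← Real.rpow_add (by norm_num)]; simp
  linear_combination (t ^ (dimE / 2) * π ^ (-(dimE / 2))) * this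

/-- Cauchy weight. -/
noncomputable def cw (b : ℝ) (y : E) : ℝ := (1 + ‖y‖ ^ 2) ^ (-b)

lemma cw_pos (b : ℝ) (y : E) : 0 < cw b y := by unfold cw; positivity

lemma cw_int {b : ℝ} (hb : dimE / 2 < b) : Integrable (cw b : E → ℝ) := by
  have := integrable_rpow_neg_one_add_norm_sq (E := E) (μ := volume) (r := 2 * b) (by linarith)
  unfold cw
  convert this using 3
  ring

lemma cw_cont (b : ℝ) : Continuous (cw b : E → ℝ) := by
  unfold cw
  apply Continuous.rpow_const (by fun_prop)
  intro x; left; positivity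

lemma gamma_cw {b : ℝ} (hb : 0 < b) (y : E) :
    ∫ t in Set.Ioi 0, t ^ (b - 1) * Real.exp (-((1 + ‖y‖ ^ 2) * t)) = Real.Gamma b * cw b y := by
  rw [Real.integral_rpow_mul_exp_neg_mul_Ioi hb (by positivity), cw, one_div,
    Real.inv_rpow (by positivity), Real.rpow_neg (by positivity)]
  ring

lemma gamma_cw_int {b : ℝ} (hb : 0 < b) (y : E) :
    IntegrableOn (fun t : ℝ => t ^ (b - 1) * Real.exp (-((1 + ‖y‖ ^ 2) * t))) (Set.Ioi 0) := by
  by_contra hcon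
  have h1 := gamma_cw hb y
  rw [integral_undef hcon] at h1
  have := mul_pos (Real.Gamma_pos_of_pos hb) (cw_pos b y)
  linarith

lemma mix_aux {b M : ℝ} (hb : dimE / 2 < b) {h : E → ℝ} (hm : Measurable h) (hM : ∀ x, |h x| ≤ M) :
    Integrable (fun p : ℝ × E => (p.1 ^ (b - 1) * Real.exp (-((1 + ‖p.2‖ ^ 2) * p.1))) * h p.2)
      ((volume.restrict (Set.Ioi 0)).prod volume) := by
  have hb0 : 0 < b := lt_of_le_of_lt (by positivity) hb
  rw [integrable_prod_iff' (by fun_prop)]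
  constructor
  · exact Eventually.of_forall fun y => Integrable.mul_const (gamma_cw_int hb0 y) (h y)
  · have : ∀ y : E, ∫ t in Set.Ioi 0,
        ‖(t ^ (b - 1) * Real.exp (-((1 + ‖y‖ ^ 2) * t))) * h y‖ =
        ‖h y‖ * (Real.Gamma b * cw b y) := by
      intro y
      rw [← gamma_cw hb0 y, ← integral_const_mul]
      apply setIntegral_congr_fun measurableSet_Ioi
      intro t ht
      have : 0 < t := ht
      simp only [norm_mul]
      rw [Real.norm_of_nonneg (by positivity), Real.norm_of_nonneg (Real.exp_pos _).le]
      ring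
    simp_rw [this]
    refine Integrable.bdd_mul (c := M) ((cw_int hb).const_mul _) (by fun_prop)
      (Eventually.of_forall fun y => ?_)
    simpa using hM y

lemma Et_gw {b t : ℝ} (ht : 0 < t) (h : E → ℝ) :
    Et h t * gw (b - dimE / 2) t = π ^ (-(dimE / 2)) *
      ∫ y, (t ^ (b - 1) * Real.exp (-((1 + ‖y‖ ^ 2) * t))) * h y := by
  rw [Et_eq h ht, gw, mul_assoc]
  congr 1
  have : ∀ y : E, (t ^ (b - 1) * Real.exp (-((1 + ‖y‖ ^ 2) * t))) * h y =
      (t ^ (b - 1) * Real.exp (-t)) * (Real.exp (-t * ‖y‖ ^ 2) * h y) := by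
    intro y
    rw [show -((1 + ‖y‖ ^ 2) * t) = -t + -t * ‖y‖ ^ 2 by ring, Real.exp_add]
    ring
  simp_rw [this]
  rw [integral_const_mul]
  have h2 : t ^ (b - 1) = t ^ (dimE / 2) * t ^ (b - dimE / 2 - 1) := by
    rw [← Real.rpow_add ht]; congr 1; ring
  rw [h2]
  ring

lemma mix {b M : ℝ} (hb : dimE / 2 < b) {h : E → ℝ} (hm : Measurable h) (hM : ∀ x, |h x| ≤ M) :
    IntegrableOn (fun t => Et h t * gw (b - dimE / 2) t) (Set.Ioi 0) ∧
    ∫ t in Set.Ioi 0, Et h t * gw (b - dimE / 2) t =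
      π ^ (-(dimE / 2)) * (Real.Gamma b * ∫ y, h y * cw b y) := by
  have hb0 : 0 < b := lt_of_le_of_lt (by positivity) hb
  have hi := mix_aux hb hm hM
  have e : Set.EqOn (fun t => Et h t * gw (b - dimE / 2) t) (fun t => π ^ (-(dimE / 2)) *
      ∫ y, (t ^ (b - 1) * Real.exp (-((1 + ‖y‖ ^ 2) * t))) * h y) (Set.Ioi 0) :=
    fun t ht => Et_gw ht h
  constructor
  · rw [integrableOn_congr_fun e measurableSet_Ioi]
    exact hi.integral_prod_left.const_mul _
  · rw [setIntegral_congr_fun measurableSet_Ioi e, integral_const_mul]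
    congr 1
    rw [integral_integral_swap hi, ← integral_const_mul]
    congr 1
    ext y
    rw [integral_mul_const, gamma_cw hb0]
    ring

variable {f : E → ℝ} {C : NNReal}

lemma scale_deriv (hf : LipschitzWith C f) {r : ℝ} (hr : r ≠ 0) {M : ℝ} (hM : ∀ x, |f x| ≤ M) :
    HasDerivAt (fun r : ℝ => ∫ x, f (r • x) ∂γ) (∫ x, inner ℝ (gradient f (r • x)) x ∂γ) r := by
  have hfc := hf.continuous
  have hG := grad_meas f
  refine (hasDerivAt_integral_of_dominated_loc_of_lip (μ := γ) (s := Set.univ)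
    (bound := fun x : E => C * ‖x‖) univ_mem
    (Eventually.of_forall fun t => ?_) ?_ ?_ ?_ ?_ ?_).2
  · exact (by fun_prop : Continuous fun x : E => f (t • x)).aestronglyMeasurable
  · refine (integrable_const M).mono' ((by fun_prop : Continuous fun x : E =>
      f (r • x)).aestronglyMeasurable) (Eventually.of_forall fun x => hM _)
  · fun_prop
  · refine Eventually.of_forall fun x => LipschitzOnWith.of_dist_le_mul fun a _ b _ => ?_
    have hnn : 0 ≤ C * ‖x‖ := by positivity
    rw [Real.coe_nnabs, abs_of_nonneg hnn]
    refine (hf.dist_le_mul _ _).trans ?_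
    rw [dist_eq_norm (a • x), ← sub_smul, norm_smul, dist_eq_norm]
    exact le_of_eq (by ring)
  · exact int_norm.const_mul _
  · have h0 : ∀ᵐ x : E, DifferentiableAt ℝ f (r • x) := by
      have := hf.ae_differentiableAt (μ := volume)
      rw [ae_iff] at this ⊢
      have h2 := Measure.addHaar_preimage_smul (volume : Measure E) hr {a | ¬DifferentiableAt ℝ f a}
      rw [this, mul_zero] at h2
      exact h2
    filter_upwards [std_ac.ae_le h0] with x hx
    have h1 : HasDerivAt (fun t : ℝ => t • x) x r := by
      simpa using (hasDerivAt_id r).smul_const x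
    rw [grad_inner]
    exact hx.hasFDerivAt.comp_hasDerivAt r h1

lemma Et_deriv (hf : LipschitzWith C f) {M : ℝ} (hM : ∀ x, |f x| ≤ M) {t : ℝ} (ht : 0 < t) :
    HasDerivAt (Et f) (-(Et (fun y => inner ℝ (gradient f y) y) t) / (2 * t)) t := by
  have hs : 0 < √(2 * t) := by positivity
  have h1 := scale_deriv hf (inv_ne_zero hs.ne') hM
  have h2 : HasDerivAt (fun t : ℝ => (√(2 * t))⁻¹) (-(√(2 * t))⁻¹ / (2 * t)) t := by
    have h3 : HasDerivAt (fun t : ℝ => 2 * t) 2 t := by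
      simpa using (hasDerivAt_id t).const_mul 2
    have h4 := (h3.sqrt (by positivity)).fun_inv hs.ne'
    refine h4.congr_deriv ?_
    rw [Real.sq_sqrt (by positivity)]
    field_simp
  have h5 := h1.comp t h2
  refine h5.congr_deriv ?_
  rw [Et]
  simp only [inner_smul_right]
  rw [integral_const_mul]
  ring

lemma grad_scale (r : ℝ) (x : E) : gradient (fun x => f (r • x)) x = r • gradient f (r • x) := by
  unfold gradient
  rw [fderiv_comp_smul]
  simp

lemma Et_poincare (hf : LipschitzWith C f) (hc : HasCompactSupport f) {t : ℝ} (ht : 0 < t)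
    (hn : 0 < dimE) :
    Et (fun y => f y ^ 2) t - (Et f t) ^ 2 +
      (Et (fun y => inner ℝ (gradient f y) y) t) ^ 2 / (2 * dimE) ≤
      (2 * t)⁻¹ * Et (fun y => ‖gradient f y‖ ^ 2) t := by
  have hs : 0 < √(2 * t) := by positivity
  set r := (√(2 * t))⁻¹ with hr
  have hr0 : r ≠ 0 := inv_ne_zero hs.ne'
  have hr2 : r ^ 2 = (2 * t)⁻¹ := by rw [hr, inv_pow, Real.sq_sqrt (by positivity)]
  have hA : LipschitzWith (‖r‖₊) (fun y : E => r • y) := lipschitzWith_smul r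
  have hcl : HasCompactSupport (fun y : E => f (r • y)) :=
    hc.comp_homeomorph (Homeomorph.smulOfNeZero r hr0)
  have key := gauss_poincare (hf.comp hA) hcl
    (Et (fun y => inner ℝ (gradient f y) y) t / dimE)
  have e1 : ∀ x : E, gradient (f ∘ fun y => r • y) x = r • gradient f (r • x) :=
    fun x => grad_scale r x
  simp only [e1, norm_smul, mul_pow, Function.comp, inner_smul_left, Real.norm_eq_abs, sq_abs,
    hr2, integral_const_mul] at key
  have e2 : ∫ x, (starRingEnd ℝ) r * inner ℝ (gradient f (r • x)) x ∂γ =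
      Et (fun y => inner ℝ (gradient f y) y) t := by
    rw [Et]; simp [inner_smul_right, hr]
  rw [integral_const_mul] at e2
  rw [e2] at key
  have e3 : (2 * (Et (fun y => inner ℝ (gradient f y) y) t / dimE) *
      Et (fun y => inner ℝ (gradient f y) y) t -
      (Et (fun y => inner ℝ (gradient f y) y) t / dimE) ^ 2 * dimE) / 2 =
      (Et (fun y => inner ℝ (gradient f y) y) t) ^ 2 / (2 * dimE) := by
    field_simp; ring
  rw [e3] at key
  simp only [Et] at key ⊢
  linarith

end mix

section assemble

local notation "γ" => stdGaussian E
local notation "dimE" => (Module.finrank ℝ E : ℝ)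

variable {f : E → ℝ} {C : NNReal}

lemma Et_meas {h : E → ℝ} (hm : Measurable h) : StronglyMeasurable (Et h) := by
  have h1 : StronglyMeasurable (fun p : ℝ × E => h ((√(2 * p.1))⁻¹ • p.2)) := by
    apply Measurable.stronglyMeasurable
    fun_prop
  exact h1.integral_prod_right (ν := γ)

lemma Et_bound {h : E → ℝ} {M : ℝ} (hM : ∀ x, |h x| ≤ M) (t : ℝ) : |Et h t| ≤ M := by
  have := norm_integral_le_of_norm_le_const (μ := γ) (f := fun x => h ((√(2 * t))⁻¹ • x)) (C := M)
    (Eventually.of_forall fun x => hM _)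
  simpa [Et] using this

lemma grad_radial_bound (hf : LipschitzWith C f) (hc : HasCompactSupport f) :
    ∃ K, ∀ y, |inner ℝ (gradient f y) y| ≤ K := by
  obtain ⟨R, hR⟩ := hc.isCompact.isBounded.exists_norm_le
  refine ⟨C * |R|, fun y => ?_⟩
  by_cases hy : y ∈ tsupport f
  · refine (abs_real_inner_le_norm _ _).trans ?_
    exact mul_le_mul (grad_bound hf y) ((hR y hy).trans (le_abs_self R)) (norm_nonneg _) C.2
  · have : fderiv ℝ f y = 0 := by
      by_contra h
      exact hy (support_fderiv_subset ℝ h)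
    rw [grad_inner, this]
    simp
    positivity

lemma cs_poincare (hf : LipschitzWith C f) (hc : HasCompactSupport f) (hn : 0 < dimE) {β : ℝ}
    (hβ : dimE + 1 ≤ β) :
    (∫ y, f y ^ 2 * cw β y) * (∫ y : E, cw β y) - (∫ y, f y * cw β y) ^ 2 ≤
      (1 / (2 * (β - 1))) * (∫ y, ‖gradient f y‖ ^ 2 * cw (β - 1) y) * (∫ y : E, cw β y) := by
  obtain ⟨M, hM0, hM⟩ := bounded_of_cs hf hc
  obtain ⟨K, hK⟩ := grad_radial_bound hf hc
  have hfm : Measurable f := hf.continuous.measurable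
  have hGm := grad_meas f
  have hAm : Measurable (fun y => inner ℝ (gradient f y) y) := by fun_prop
  have hb : dimE / 2 < β := by linarith
  have hb1 : dimE / 2 < β - 1 := by linarith
  have hn1 : 1 ≤ dimE := by
    have : 0 < Module.finrank ℝ E := by exact_mod_cast hn
    exact_mod_cast this
  obtain ⟨-, m1⟩ := mix hb (h := fun _ : E => (1:ℝ)) (M := 1) (by fun_prop) (by simp)
  obtain ⟨if1, mf1⟩ := mix hb hfm hM
  obtain ⟨if2, mf2⟩ := mix hb (h := fun y => f y ^ 2) (M := M ^ 2) (by fun_prop) (fun x => by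
    rw [abs_pow]; exact pow_le_pow_left₀ (abs_nonneg _) (hM x) 2)
  obtain ⟨ig, mg⟩ := mix hb1 (h := fun y => ‖gradient f y‖ ^ 2) (M := (C:ℝ) ^ 2) (by fun_prop)
    (fun x => by
      rw [abs_of_nonneg (by positivity)]
      exact pow_le_pow_left₀ (norm_nonneg _) (grad_bound hf x) 2)
  set a := β - dimE / 2 with ha
  have ha1 : 1 < a := by rw [ha]; linarith
  have haw : dimE / 2 ≤ a - 1 := by rw [ha]; linarith
  set F := Et f with hF
  set A := Et (fun y => inner ℝ (gradient f y) y) with hA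
  have hFb : ∀ t, |F t| ≤ M := fun t => Et_bound hM t
  have hAb : ∀ t, |A t| ≤ K := fun t => Et_bound hK t
  obtain ⟨c, hcM, hgam⟩ := gamma_poincare (F := F) (F' := fun t => -(A t) / (2 * t)) (M := M)
    (K := K / 2) ha1 (fun t ht => Et_deriv hf hM ht) (fun t _ => hFb t) (fun t ht => by
      rw [show t * (-(A t) / (2 * t)) = -(A t) / 2 by field_simp, abs_div, abs_neg]
      have := hAb t
      simp
      linarith)
  have hA2 : ∫ t in Set.Ioi 0, (t * (-(A t) / (2 * t))) ^ 2 * gw a t =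
      (1 / 4) * ∫ t in Set.Ioi 0, A t ^ 2 * gw a t := by
    rw [← integral_const_mul]
    apply setIntegral_congr_fun measurableSet_Ioi
    intro t ht
    have : t ≠ 0 := (ne_of_gt ht)
    simp only
    field_simp
    ring
  rw [hA2] at hgam
  have ha0 : 0 < a := by linarith
  have iW : IntegrableOn (gw a) (Set.Ioi 0) := gw_int ha0
  have iF2 : IntegrableOn (fun t => F t ^ 2 * gw a t) (Set.Ioi 0) :=
    int_bdd_gw (M := M ^ 2) ha0 (((Et_meas hfm).pow 2).aestronglyMeasurable) (fun t _ => by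
      rw [abs_pow]; exact pow_le_pow_left₀ (abs_nonneg _) (hFb t) 2)
  have iA2 : IntegrableOn (fun t => A t ^ 2 * gw a t) (Set.Ioi 0) :=
    int_bdd_gw (M := K ^ 2) ha0 (((Et_meas hAm).pow 2).aestronglyMeasurable) (fun t _ => by
      rw [abs_pow]; exact pow_le_pow_left₀ (abs_nonneg _) (hAb t) 2)
  have m1' : ∫ t in Set.Ioi 0, gw a t = π ^ (-(dimE / 2)) * (Real.Gamma β * ∫ y : E, cw β y) := by
    have e : Et (fun _ : E => (1:ℝ)) = fun _ => 1 := by ext t; simp [Et]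
    simpa [e] using m1
  have hexp : ∫ t in Set.Ioi 0, (F t - c) ^ 2 * gw a t = (∫ t in Set.Ioi 0, F t ^ 2 * gw a t)
      - 2 * c * (∫ t in Set.Ioi 0, F t * gw a t) + c ^ 2 * ∫ t in Set.Ioi 0, gw a t := by
    have i3 : IntegrableOn (fun t => F t ^ 2 * gw a t - 2 * c * (F t * gw a t)) (Set.Ioi 0) :=
      iF2.sub (if1.const_mul _)
    rw [← integral_const_mul, ← integral_const_mul, ← integral_sub iF2 (if1.const_mul _),
      ← integral_add i3 (iW.const_mul _)]
    congr 1
    ext t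
    ring
  -- integrate the Gaussian inequality
  have hintg : (∫ t in Set.Ioi 0, Et (fun y => f y ^ 2) t * gw a t)
      - (∫ t in Set.Ioi 0, F t ^ 2 * gw a t) + (1 / (2 * dimE)) * (∫ t in Set.Ioi 0, A t ^ 2 * gw a t)
      ≤ (1 / 2) * ∫ t in Set.Ioi 0, Et (fun y => ‖gradient f y‖ ^ 2) t * gw (β - 1 - dimE / 2) t := by
    have i3 : IntegrableOn (fun t => Et (fun y => f y ^ 2) t * gw a t - F t ^ 2 * gw a t)
      (Set.Ioi 0) := if2.sub iF2
    rw [← integral_const_mul, ← integral_const_mul, ← integral_sub if2 iF2,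
      ← integral_add i3 (iA2.const_mul _)]
    apply setIntegral_mono_on (i3.add (iA2.const_mul _)) (ig.const_mul _)
      measurableSet_Ioi
    intro t ht
    have ht : 0 < t := ht
    have h1 := Et_poincare hf hc ht hn
    have h2 := mul_le_mul_of_nonneg_right h1 (gw_nonneg (a := a) ht)
    have h3 : gw a t = t * gw (β - 1 - dimE / 2) t := by
      unfold gw
      rw [show a - 1 = 1 + (β - 1 - dimE / 2 - 1) by rw [ha]; ring, Real.rpow_add ht, Real.rpow_one]
      ring
    have h4 : (2 * t)⁻¹ * Et (fun y => ‖gradient f y‖ ^ 2) t * gw a t =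
        1 / 2 * (Et (fun y => ‖gradient f y‖ ^ 2) t * gw (β - 1 - dimE / 2) t) := by
      rw [h3]; field_simp
    rw [h4] at h2
    refine le_trans (le_of_eq ?_) h2
    simp only [hF, hA, Pi.add_apply]
    ring
  rw [mf2, mg] at hintg
  rw [hexp, mf1, m1'] at hgam
  set S := ∫ t in Set.Ioi 0, A t ^ 2 * gw a t
  set I2 := ∫ t in Set.Ioi 0, F t ^ 2 * gw a t
  set Zb := ∫ y : E, cw β y
  set k := π ^ (-(dimE / 2))
  have hk : 0 < k := by positivity
  have hZ : 0 ≤ Zb := integral_nonneg fun y => (cw_pos _ _).le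
  have hG : Real.Gamma β = (β - 1) * Real.Gamma (β - 1) := by
    have := Real.Gamma_add_one (s := β - 1) (by linarith)
    simpa using this
  have hG1 : 0 < Real.Gamma (β - 1) := Real.Gamma_pos_of_pos (by linarith)
  set P := ∫ y, f y ^ 2 * cw β y
  set Q := ∫ y, f y * cw β y
  set D := ∫ y, ‖gradient f y‖ ^ 2 * cw (β - 1) y
  set g := Real.Gamma β with hg
  have hgp : 0 < g := Real.Gamma_pos_of_pos (by linarith)
  set V := I2 - 2 * c * (k * (g * Q)) + c ^ 2 * (k * (g * Zb)) with hV
  have hV0 : 0 ≤ V := by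
    rw [hV, ← mf1, ← m1', ← hexp]
    apply setIntegral_nonneg measurableSet_Ioi
    intro t ht
    exact mul_nonneg (sq_nonneg _) (gw_nonneg ht)
  have hSV : V ≤ 1 / (2 * dimE) * S := by
    have h1 : dimE / 2 * V ≤ 1 / 4 * S := (mul_le_mul_of_nonneg_right haw hV0).trans hgam
    rw [one_div, ← div_eq_inv_mul, le_div_iff₀ (by linarith)]
    linarith
  have h5 : k * (g * P) - 2 * c * (k * (g * Q)) + c ^ 2 * (k * (g * Zb)) ≤
      1 / 2 * (k * (Real.Gamma (β - 1) * D)) := by linarith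
  have h6 : P - 2 * c * Q + c ^ 2 * Zb ≤ 1 / (2 * (β - 1)) * D := by
    have hb0 : 0 < β - 1 := by linarith
    have e : 1 / 2 * (k * (Real.Gamma (β - 1) * D)) = (k * g) * (1 / (2 * (β - 1)) * D) := by
      rw [hG]; field_simp
    rw [e] at h5
    exact le_of_mul_le_mul_left (by linarith) (mul_pos hk hgp)
  have h7 := mul_le_mul_of_nonneg_right h6 hZ
  nlinarith [sq_nonneg (Q - c * Zb)]

end assemble

section cutoff

local notation "dimE" => (Module.finrank ℝ E : ℝ)

/-- A fixed smooth bump function. -/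
noncomputable def bmp : ContDiffBump (0 : E) := ⟨1, 2, one_pos, one_lt_two⟩

/-- Rescaled cutoff. -/
noncomputable def phi (k : ℕ) (x : E) : ℝ := (bmp : ContDiffBump (0 : E)) (((k:ℝ) + 1)⁻¹ • x)

lemma phi_contDiff (k : ℕ) : ContDiff ℝ 1 (phi k : E → ℝ) := by
  unfold phi
  exact (bmp : ContDiffBump (0 : E)).contDiff.comp (by fun_prop)

lemma phi_nonneg (k : ℕ) (x : E) : 0 ≤ phi k x := ContDiffBump.nonneg _

lemma phi_le_one (k : ℕ) (x : E) : phi k x ≤ 1 := ContDiffBump.le_one _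

lemma phi_one {k : ℕ} {x : E} (hx : ‖x‖ ≤ k + 1) : phi k x = 1 := by
  apply ContDiffBump.one_of_mem_closedBall
  rw [mem_closedBall_zero_iff, norm_smul, norm_inv, Real.norm_of_nonneg (by positivity)]
  show _ ≤ (1:ℝ)
  rw [inv_mul_le_iff₀ (by positivity)]
  linarith

lemma phi_zero {k : ℕ} {x : E} (hx : 2 * ((k:ℝ) + 1) ≤ ‖x‖) : phi k x = 0 := by
  apply ContDiffBump.zero_of_le_dist
  rw [dist_zero_right, norm_smul, norm_inv, Real.norm_of_nonneg (by positivity)]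
  show (2:ℝ) ≤ _
  rw [← div_eq_inv_mul, le_div_iff₀ (by positivity)]
  linarith

lemma phi_lip : ∃ L : NNReal, ∀ k : ℕ, LipschitzWith (L * ‖((k:ℝ) + 1)⁻¹‖₊) (phi k : E → ℝ) := by
  obtain ⟨L, hL⟩ := ContDiff.lipschitzWith_of_hasCompactSupport (𝕂 := ℝ)
    (bmp : ContDiffBump (0 : E)).hasCompactSupport
    ((bmp : ContDiffBump (0 : E)).contDiff (n := 1)) one_ne_zero
  exact ⟨L, fun k => hL.comp (lipschitzWith_smul _)⟩

lemma phi_grad : ∃ L : ℝ, ∀ (k : ℕ) (x : E), ‖gradient (phi k) x‖ ^ 2 * (1 + ‖x‖ ^ 2) ≤ L := by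
  obtain ⟨L, hL⟩ := phi_lip (E := E)
  refine ⟨5 * L ^ 2, fun k x => ?_⟩
  by_cases hx : ‖x‖ ≤ 2 * ((k:ℝ) + 1)
  · have h1 := grad_bound (hL k) x
    push_cast at h1
    rw [norm_inv, Real.norm_of_nonneg (by positivity), ← div_eq_mul_inv] at h1
    have h2 : ‖gradient (phi k) x‖ ^ 2 ≤ (L / ((k:ℝ) + 1)) ^ 2 :=
      pow_le_pow_left₀ (norm_nonneg _) h1 2
    have h3 : 1 + ‖x‖ ^ 2 ≤ 5 * ((k:ℝ) + 1) ^ 2 := by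
      have := pow_le_pow_left₀ (norm_nonneg _) hx 2
      have h4 : (0:ℝ) ≤ k := by positivity
      nlinarith
    refine (mul_le_mul h2 h3 (by positivity) (by positivity)).trans (le_of_eq ?_)
    field_simp
  · push Not at hx
    have : phi k =ᶠ[𝓝 x] fun _ => (0:ℝ) := by
      filter_upwards [(isOpen_lt continuous_const continuous_norm).mem_nhds hx] with y hy
      exact phi_zero (le_of_lt hy)
    rw [this.gradient_eq]
    simp

variable {f : E → ℝ}

lemma cut_cs (k : ℕ) : HasCompactSupport (fun x => phi k x * f x) := by
  apply HasCompactSupport.intro (isCompact_closedBall (0:E) (2 * ((k:ℝ) + 1)))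
  intro x hx
  rw [mem_closedBall_zero_iff, not_le] at hx
  simp [phi_zero hx.le]

lemma cut_lip (hf : LocallyLipschitz f) (k : ℕ) :
    ∃ C, LipschitzWith C (fun x => phi k x * f x) := by
  set R : ℝ := 2 * ((k:ℝ) + 1) with hR
  have hB : IsCompact (Metric.closedBall (0:E) (R + 1)) := isCompact_closedBall _ _
  obtain ⟨K, hK⟩ := (hf.locallyLipschitzOn (s := Metric.closedBall (0:E) (R + 1))).exists_lipschitzOnWith_of_compact hB
  obtain ⟨M, hM⟩ := hB.exists_bound_of_continuousOn hf.continuous.continuousOn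
  obtain ⟨L, hL⟩ := phi_lip (E := E)
  have hL := hL k
  set L' := L * ‖((k:ℝ) + 1)⁻¹‖₊
  set N := Real.toNNReal M
  have hN : ∀ x ∈ Metric.closedBall (0:E) (R + 1), |f x| ≤ N := fun x hx =>
    (hM x hx).trans (Real.le_coe_toNNReal M)
  have key : ∀ x y : E, ‖x‖ ≤ R → |phi k x * f x - phi k y * f y| ≤ (K + N * L' + N) * ‖x - y‖ := by
    intro x y hx
    have hxB : x ∈ Metric.closedBall (0:E) (R + 1) := by
      rw [mem_closedBall_zero_iff]; linarith
    have hK0 : 0 ≤ (K:ℝ) * ‖x - y‖ := by positivity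
    have hN0 : 0 ≤ (N:ℝ) * ‖x - y‖ := by positivity
    have hNL0 : 0 ≤ (N:ℝ) * L' * ‖x - y‖ := by positivity
    by_cases hy : ‖y‖ ≤ R + 1
    · have hyB : y ∈ Metric.closedBall (0:E) (R + 1) := by
        rw [mem_closedBall_zero_iff]; linarith
      have h1 := hK.dist_le_mul x hxB y hyB
      have h2 := hL.dist_le_mul x y
      rw [dist_eq_norm, dist_eq_norm, Real.norm_eq_abs] at h1 h2
      have e : phi k x * f x - phi k y * f y = phi k y * (f x - f y) + f x * (phi k x - phi k y) := by
        ring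
      rw [e]
      refine (abs_add_le _ _).trans ?_
      rw [abs_mul, abs_mul, abs_of_nonneg (phi_nonneg k y)]
      have h3 : phi k y * |f x - f y| ≤ 1 * (K * ‖x - y‖) :=
        mul_le_mul (phi_le_one k y) h1 (abs_nonneg _) zero_le_one
      have h4 : |f x| * |phi k x - phi k y| ≤ N * (L' * ‖x - y‖) :=
        mul_le_mul (hN x hxB) h2 (abs_nonneg _) (by positivity)
      linarith
    · push Not at hy
      rw [phi_zero (by linarith : 2 * ((k:ℝ) + 1) ≤ ‖y‖), zero_mul, sub_zero, abs_mul,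
        abs_of_nonneg (phi_nonneg k x)]
      have h1 : phi k x * |f x| ≤ 1 * N :=
        mul_le_mul (phi_le_one k x) (hN x hxB) (abs_nonneg _) zero_le_one
      have h2 : 1 ≤ ‖x - y‖ := by
        have := norm_sub_norm_le y x
        rw [norm_sub_rev] at this
        linarith
      have h3 : (N:ℝ) ≤ N * ‖x - y‖ := le_mul_of_one_le_right (by positivity) h2
      linarith
  refine ⟨K + N * L' + N, LipschitzWith.of_dist_le_mul fun x y => ?_⟩
  rw [dist_eq_norm, dist_eq_norm, Real.norm_eq_abs]
  push_cast
  by_cases hx : ‖x‖ ≤ R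
  · exact key x y hx
  by_cases hy : ‖y‖ ≤ R
  · rw [abs_sub_comm, norm_sub_rev]
    exact key y x hy
  · push Not at hx hy
    rw [phi_zero hx.le, phi_zero hy.le]
    simp
    positivity

lemma cut_eq (k : ℕ) {x : E} (hx : ‖x‖ < k + 1) : (fun x => phi k x * f x) =ᶠ[𝓝 x] f := by
  filter_upwards [(isOpen_lt continuous_norm continuous_const).mem_nhds hx] with y hy
  rw [phi_one (le_of_lt hy), one_mul]

lemma loc_ae_diff (hf : LocallyLipschitz f) : ∀ᵐ x : E, DifferentiableAt ℝ f x := by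
  have : ∀ k : ℕ, ∀ᵐ x : E, DifferentiableAt ℝ (fun x => phi k x * f x) x := by
    intro k
    obtain ⟨C, hC⟩ := cut_lip hf k
    exact hC.ae_differentiableAt
  filter_upwards [ae_all_iff.2 this] with x hx
  obtain ⟨k, hk⟩ := exists_nat_gt ‖x‖
  exact (cut_eq k (by linarith)).differentiableAt_iff.1 (hx k)

lemma cut_grad {k : ℕ} {x : E} (hx : DifferentiableAt ℝ f x) :
    ‖gradient (fun x => phi k x * f x) x‖ ≤ ‖gradient f x‖ + |f x| * ‖gradient (phi k) x‖ := by
  have h1 : DifferentiableAt ℝ (phi k) x := (phi_contDiff k).differentiable one_ne_zero x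
  rw [grad_norm, grad_norm, grad_norm, fderiv_fun_mul h1 hx]
  refine (norm_add_le _ _).trans ?_
  rw [norm_smul, norm_smul, Real.norm_of_nonneg (phi_nonneg k x), Real.norm_eq_abs]
  have := mul_le_mul_of_nonneg_right (phi_le_one k x) (norm_nonneg (fderiv ℝ f x))
  linarith

lemma cw_sub_one (b : ℝ) (y : E) : cw (b - 1) y = (1 + ‖y‖ ^ 2) * cw b y := by
  unfold cw
  rw [show -(b - 1) = 1 + -b by ring, Real.rpow_add (by positivity), Real.rpow_one]

theorem loc_poincare (hf : LocallyLipschitz f) (hn : 0 < dimE) {β : ℝ} (hβ : dimE + 1 ≤ β)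
    (h2 : Integrable fun x => f x ^ 2 * cw β x) (h1 : Integrable fun x => f x * cw β x)
    (hg : Integrable fun x => ‖gradient f x‖ ^ 2 * (1 + ‖x‖ ^ 2) * cw β x) :
    (∫ y, f y ^ 2 * cw β y) * (∫ y : E, cw β y) - (∫ y, f y * cw β y) ^ 2 ≤
      (1 / (2 * (β - 1))) * (∫ y, ‖gradient f y‖ ^ 2 * (1 + ‖y‖ ^ 2) * cw β y) *
        (∫ y : E, cw β y) := by
  obtain ⟨L, hL⟩ := phi_grad (E := E)
  have hfm : Measurable f := hf.continuous.measurable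
  have hpm : ∀ k, Measurable (phi k : E → ℝ) := fun k => (phi_contDiff k).continuous.measurable
  have hcm : Measurable (cw β : E → ℝ) := (cw_cont β).measurable
  have hp1 : ∀ k (x : E), |phi k x| ≤ 1 := fun k x => by
    rw [abs_of_nonneg (phi_nonneg k x)]; exact phi_le_one k x
  have hev : ∀ x : E, ∀ᶠ k : ℕ in atTop, ‖x‖ < k + 1 := by
    intro x
    obtain ⟨k, hk⟩ := exists_nat_gt ‖x‖
    filter_upwards [eventually_ge_atTop k] with j hj
    have : (k:ℝ) ≤ j := by exact_mod_cast hj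
    linarith
  have t2 : Tendsto (fun k : ℕ => ∫ y, (phi k y * f y) ^ 2 * cw β y) atTop
      (𝓝 (∫ y, f y ^ 2 * cw β y)) := by
    refine tendsto_integral_of_dominated_convergence (fun x => f x ^ 2 * cw β x)
      (fun k => ?_) h2 (fun k => Eventually.of_forall fun x => ?_)
      (Eventually.of_forall fun x => ?_)
    · have := hpm k
      exact (by fun_prop : Measurable _).aestronglyMeasurable
    · rw [norm_mul, Real.norm_of_nonneg (cw_pos β x).le, norm_pow, norm_mul, mul_pow,
        Real.norm_eq_abs, Real.norm_eq_abs, sq_abs (f x)]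
      have h3 : |phi k x| ^ 2 ≤ 1 := pow_le_one₀ (abs_nonneg _) (hp1 k x)
      have h4 : 0 ≤ f x ^ 2 * cw β x := mul_nonneg (sq_nonneg _) (cw_pos β x).le
      nlinarith
    · apply tendsto_const_nhds.congr'
      filter_upwards [hev x] with k hk
      rw [phi_one hk.le, one_mul]
  have t1 : Tendsto (fun k : ℕ => ∫ y, (phi k y * f y) * cw β y) atTop
      (𝓝 (∫ y, f y * cw β y)) := by
    refine tendsto_integral_of_dominated_convergence (fun x => |f x * cw β x|)
      (fun k => ?_) h1.abs (fun k => Eventually.of_forall fun x => ?_)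
      (Eventually.of_forall fun x => ?_)
    · have := hpm k
      exact (by fun_prop : Measurable _).aestronglyMeasurable
    · rw [mul_assoc, norm_mul, Real.norm_eq_abs, Real.norm_eq_abs]
      exact mul_le_of_le_one_left (abs_nonneg _) (hp1 k x)
    · apply tendsto_const_nhds.congr'
      filter_upwards [hev x] with k hk
      rw [phi_one hk.le, one_mul]
  have tg : Tendsto (fun k : ℕ => ∫ y, ‖gradient (fun x => phi k x * f x) y‖ ^ 2 * cw (β - 1) y)
      atTop (𝓝 (∫ y, ‖gradient f y‖ ^ 2 * (1 + ‖y‖ ^ 2) * cw β y)) := by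
    refine tendsto_integral_of_dominated_convergence (fun x =>
      2 * (‖gradient f x‖ ^ 2 * (1 + ‖x‖ ^ 2) * cw β x) + (2 * L) * (f x ^ 2 * cw β x))
      (fun k => ?_) ((hg.const_mul _).add (h2.const_mul _)) (fun k => ?_)
      (Eventually.of_forall fun x => ?_)
    · have := grad_meas (fun x => phi k x * f x)
      have h3 : Measurable (cw (β - 1) : E → ℝ) := (cw_cont _).measurable
      exact (by fun_prop : Measurable _).aestronglyMeasurable
    · filter_upwards [loc_ae_diff hf] with x hx
      have h3 := pow_le_pow_left₀ (norm_nonneg _) (cut_grad (k := k) hx) 2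
      have h4 := hL k x
      have hc := cw_pos β x
      rw [Real.norm_of_nonneg (mul_nonneg (by positivity) (cw_pos _ x).le), cw_sub_one, ← mul_assoc]
      set u := ‖gradient f x‖
      set v := ‖gradient (phi k) x‖
      set w := 1 + ‖x‖ ^ 2 with hw
      have hw0 : 0 ≤ w := by positivity
      have h5 : (u + |f x| * v) ^ 2 ≤ 2 * u ^ 2 + 2 * (f x ^ 2 * v ^ 2) := by
        have := sq_nonneg (u - |f x| * v)
        have e : (|f x| * v) ^ 2 = f x ^ 2 * v ^ 2 := by rw [mul_pow, sq_abs]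
        nlinarith
      have h6 := mul_le_mul_of_nonneg_right (h3.trans h5) hw0
      have h7 := mul_le_mul_of_nonneg_left h4 (sq_nonneg (f x))
      have h8 : ‖gradient (fun x => phi k x * f x) x‖ ^ 2 * w ≤ 2 * (u ^ 2 * w) + 2 * L * f x ^ 2 := by
        linarith
      have h9 := mul_le_mul_of_nonneg_right h8 hc.le
      linarith
    · apply tendsto_const_nhds.congr'
      filter_upwards [hev x] with k hk
      rw [(cut_eq k hk).gradient_eq, cw_sub_one]
      ring
  refine le_of_tendsto_of_tendsto' ((t2.mul_const _).sub (t1.pow 2))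
    ((tg.const_mul (1 / (2 * (β - 1)))).mul_const _) fun k => ?_
  obtain ⟨C, hC⟩ := cut_lip hf k
  exact cs_poincare hC (cut_cs k) hn hβ

end cutoff

end WPC

theorem weighted_poincare_cauchy (n : ℕ) (β : ℝ) (hβ : β ≥ n + 1)
    (Z : ℝ) (hZ : Z = ∫ x : EuclideanSpace ℝ (Fin n), (1 + ‖x‖ ^ 2) ^ (-β))
    (f : EuclideanSpace ℝ (Fin n) → ℝ) (hf : LocallyLipschitz f)
    (hf2 : Integrable (fun x : EuclideanSpace ℝ (Fin n) =>
      (f x) ^ 2 * ((1 + ‖x‖ ^ 2) ^ (-β) / Z)))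
    (hf1 : Integrable (fun x : EuclideanSpace ℝ (Fin n) =>
      f x * ((1 + ‖x‖ ^ 2) ^ (-β) / Z)))
    (hrhs : Integrable (fun x : EuclideanSpace ℝ (Fin n) =>
      ‖gradient f x‖ ^ 2 * (1 + ‖x‖ ^ 2) * ((1 + ‖x‖ ^ 2) ^ (-β) / Z))) :
    (∫ x : EuclideanSpace ℝ (Fin n), (f x) ^ 2 * ((1 + ‖x‖ ^ 2) ^ (-β) / Z)) -
      (∫ x : EuclideanSpace ℝ (Fin n), f x * ((1 + ‖x‖ ^ 2) ^ (-β) / Z)) ^ 2 ≤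
      (1 / (2 * (β - 1))) *
        ∫ x : EuclideanSpace ℝ (Fin n),
          ‖gradient f x‖ ^ 2 * (1 + ‖x‖ ^ 2) * ((1 + ‖x‖ ^ 2) ^ (-β) / Z) := by
  have hdim : (Module.finrank ℝ (EuclideanSpace ℝ (Fin n)) : ℝ) = n := by simp
  have hb : (Module.finrank ℝ (EuclideanSpace ℝ (Fin n)) : ℝ) / 2 < β := by
    rw [hdim]
    have : (0:ℝ) ≤ n := by positivity
    linarith
  have hZ' : Z = ∫ x : (EuclideanSpace ℝ (Fin n)), WPC.cw β x := hZ
  have hZ0 : 0 < Z := by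
    rw [hZ', integral_pos_iff_support_of_nonneg (fun x => (WPC.cw_pos β x).le) (WPC.cw_int hb)]
    have : Function.support (WPC.cw β : (EuclideanSpace ℝ (Fin n)) → ℝ) = Set.univ :=
      Set.eq_univ_of_forall fun x => (WPC.cw_pos β x).ne'
    rw [this]
    exact (isOpen_univ.measure_pos volume Set.univ_nonempty)
  have hconv : ∀ g : (EuclideanSpace ℝ (Fin n)) → ℝ, (fun x => g x * ((1 + ‖x‖ ^ 2) ^ (-β) / Z)) =
      fun x => (g x * WPC.cw β x) * Z⁻¹ := by
    intro g
    ext x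
    rw [WPC.cw]
    ring
  have hu : IsUnit Z⁻¹ := (inv_ne_zero hZ0.ne').isUnit
  have h2 := hf2
  have h1 := hf1
  have hg := hrhs
  rw [hconv fun x => f x ^ 2, integrable_mul_const_iff hu] at h2
  rw [hconv f, integrable_mul_const_iff hu] at h1
  rw [hconv fun x => ‖gradient f x‖ ^ 2 * (1 + ‖x‖ ^ 2), integrable_mul_const_iff hu] at hg
  rw [hconv fun x => f x ^ 2, hconv f, hconv fun x => ‖gradient f x‖ ^ 2 * (1 + ‖x‖ ^ 2),
    integral_mul_const, integral_mul_const, integral_mul_const]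
  have key : (∫ y, f y ^ 2 * WPC.cw β y) * Z - (∫ y, f y * WPC.cw β y) ^ 2 ≤
      (1 / (2 * (β - 1))) * (∫ y, ‖gradient f y‖ ^ 2 * (1 + ‖y‖ ^ 2) * WPC.cw β y) * Z := by
    rcases Nat.eq_zero_or_pos n with hn | hn
    · subst hn
      have hs : ∀ x : (EuclideanSpace ℝ (Fin 0)), x = 0 := fun x => Subsingleton.elim x 0
      have e2 : ∫ y, f y ^ 2 * WPC.cw β y = f 0 ^ 2 * Z := by
        rw [hZ', ← integral_const_mul]
        congr 1
        ext y
        rw [hs y]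
      have e1 : ∫ y, f y * WPC.cw β y = f 0 * Z := by
        rw [hZ', ← integral_const_mul]
        congr 1
        ext y
        rw [hs y]
      have e3 : 0 ≤ ∫ y, ‖gradient f y‖ ^ 2 * (1 + ‖y‖ ^ 2) * WPC.cw β y :=
        integral_nonneg fun y => mul_nonneg (by positivity) (WPC.cw_pos β y).le
      rw [e1, e2]
      have hb1 : 0 ≤ β - 1 := by simp at hβ; linarith
      have : 0 ≤ (1 / (2 * (β - 1))) *
          (∫ y, ‖gradient f y‖ ^ 2 * (1 + ‖y‖ ^ 2) * WPC.cw β y) * Z := by positivity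
      refine le_trans (le_of_eq ?_) this
      ring
    · rw [hZ']
      refine WPC.loc_poincare hf ?_ ?_ h2 h1 hg
      · rw [hdim]; exact_mod_cast hn
      · rw [hdim]; exact hβ
  set P := ∫ y, f y ^ 2 * WPC.cw β y
  set Q := ∫ y, f y * WPC.cw β y
  set D := ∫ y, ‖gradient f y‖ ^ 2 * (1 + ‖y‖ ^ 2) * WPC.cw β y
  have h3 := mul_le_mul_of_nonneg_right key (sq_nonneg Z⁻¹)
  have e1 : (P * Z - Q ^ 2) * Z⁻¹ ^ 2 = P * Z⁻¹ - (Q * Z⁻¹) ^ 2 := by field_simp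
  have e2 : 1 / (2 * (β - 1)) * D * Z * Z⁻¹ ^ 2 = 1 / (2 * (β - 1)) * (D * Z⁻¹) := by
    rw [pow_two]
    have : Z * Z⁻¹ = 1 := mul_inv_cancel₀ hZ0.ne'
    linear_combination (1 / (2 * (β - 1)) * D * Z⁻¹) * this
  rw [e1, e2] at h3
  exact h3
end
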